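/- arXiv:1707.08786 — 3 statements merged into one kernel-verified Lean document; each statement's English description precedes it below -/
import Mathlib

section
/- Let F : ℝ^n → ℝ^n be a piecewise affine function and let 𝒫(F) be a corresponding polyhedral subdivision of ℝ^n. If the linear parts of all selection functions of F that are active on unbounded polyhedra of 𝒫(F) have the same nonzero determinant sign (i.e. the determinants of the matrices A_i for those selection functions are all positive, or all negative), then F is surjective. -/
open Set Filter Bornology

noncomputable section

/-- A (closed convex) polyhedron in `ℝⁿ`: a finite intersection of closed halfspaces. -/
def IsPolyhedron {n : ℕ} (P : Set (Fin n → ℝ)) : Prop :=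
  ∃ (m : ℕ) (a : Fin m → (Fin n → ℝ)) (c : Fin m → ℝ),
    P = {x | ∀ i, (∑ j, a i j * x j) ≤ c i}

/-- `G` is a proper face of the polyhedron `P`: `G ≠ P` and `G` is either empty or the
intersection of `P` with a supporting hyperplane. -/
def IsProperFaceOf {n : ℕ} (G P : Set (Fin n → ℝ)) : Prop :=
  G ≠ P ∧ (G = ∅ ∨ ∃ (a : Fin n → ℝ) (c : ℝ),
    (∀ x ∈ P, (∑ j, a j * x j) ≤ c) ∧ G = {x ∈ P | (∑ j, a j * x j) = c})

/-- The affine map `x ↦ A x + b` encoded by the pair `p = (A, b)`. -/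
def affMap {n : ℕ} (p : Matrix (Fin n) (Fin n) ℝ × (Fin n → ℝ)) :
    (Fin n → ℝ) → (Fin n → ℝ) :=
  fun x => p.1.mulVec x + p.2

/-- The selection function `p` is active (for `F`) on the set `U`. -/
def ActiveOn {n : ℕ} (F : (Fin n → ℝ) → (Fin n → ℝ))
    (p : Matrix (Fin n) (Fin n) ℝ × (Fin n → ℝ)) (U : Set (Fin n → ℝ)) : Prop :=
  ∀ x ∈ U, F x = affMap p x

/-- `F` is piecewise affine with (finite) set of selection functions `S`. -/
def IsPWA {n : ℕ} (F : (Fin n → ℝ) → (Fin n → ℝ))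
    (S : Finset (Matrix (Fin n) (Fin n) ℝ × (Fin n → ℝ))) : Prop :=
  Continuous F ∧ ∀ x, ∃ p ∈ S, F x = affMap p x

/-- `𝒞` is a polyhedral subdivision of `ℝⁿ` corresponding to the piecewise affine `F`
with selection functions `S`. -/
def IsSubdivision {n : ℕ} (F : (Fin n → ℝ) → (Fin n → ℝ))
    (S : Finset (Matrix (Fin n) (Fin n) ℝ × (Fin n → ℝ)))
    (𝒞 : Set (Set (Fin n → ℝ))) : Prop :=
  𝒞.Finite ∧
  (∀ P ∈ 𝒞, IsPolyhedron P ∧ (interior P).Nonempty) ∧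
  ⋃₀ 𝒞 = univ ∧
  (∀ P ∈ 𝒞, ∃ p ∈ S, ActiveOn F p P) ∧
  (∀ P ∈ 𝒞, ∀ Q ∈ 𝒞, P ≠ Q →
    P ∩ Q = ∅ ∨ (IsProperFaceOf (P ∩ Q) P ∧ IsProperFaceOf (P ∩ Q) Q))

/-- `F` is nonsingular at infinity w.r.t. the subdivision `𝒞`: every selection function
active on an unbounded polyhedron of `𝒞` has invertible linear part. -/
def NonsingularAtInfinity {n : ℕ} (F : (Fin n → ℝ) → (Fin n → ℝ))
    (S : Finset (Matrix (Fin n) (Fin n) ℝ × (Fin n → ℝ)))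
    (𝒞 : Set (Set (Fin n → ℝ))) : Prop :=
  ∀ p ∈ S, ∀ P ∈ 𝒞, ¬ IsBounded P → ActiveOn F p P → p.1.det ≠ 0

/-- `y` is a regular value of `F`. -/
def IsRegularValue {n : ℕ} (F : (Fin n → ℝ) → (Fin n → ℝ)) (y : Fin n → ℝ) : Prop :=
  ∀ x, F x = y → DifferentiableAt ℝ F x ∧ (fderiv ℝ F x).det ≠ 0

/-- The signed count of preimages of `y` under `F`. -/
def degSum {n : ℕ} (F : (Fin n → ℝ) → (Fin n → ℝ)) (y : Fin n → ℝ) : ℝ :=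
  ∑ᶠ x ∈ F ⁻¹' {y}, Real.sign ((fderiv ℝ F x).det)

open MeasureTheory Topology
open scoped NNReal ENNReal

/-- A continuous function that is a selection of finitely many affine maps is Lipschitz. -/
theorem IsPWA.exists_lipschitzWith {n : ℕ} {F : (Fin n → ℝ) → (Fin n → ℝ)}
    {S : Finset (Matrix (Fin n) (Fin n) ℝ × (Fin n → ℝ))} (hF : IsPWA F S) :
    ∃ L : ℝ≥0, LipschitzWith L F := by
  obtain ⟨hc, hsel⟩ := hF
  let N : Matrix (Fin n) (Fin n) ℝ × (Fin n → ℝ) → ℝ≥0 := fun p =>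
    ‖(Matrix.toLin' p.1).toContinuousLinearMap‖₊
  refine ⟨∑ p ∈ S, N p, LipschitzWith.of_dist_le_mul fun y x => ?_⟩
  rw [dist_eq_norm, dist_eq_norm]
  set L : ℝ≥0 := ∑ p ∈ S, N p
  have hN : ∀ p ∈ S, ∀ u v, ‖affMap p u - affMap p v‖ ≤ L * ‖u - v‖ := by
    intro p hp u v
    have h1 : affMap p u - affMap p v = (Matrix.toLin' p.1).toContinuousLinearMap (u - v) := by
      simp [affMap, Matrix.mulVec_sub]
    rw [h1]
    refine (ContinuousLinearMap.le_opNorm _ _).trans ?_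
    gcongr
    exact_mod_cast Finset.single_le_sum (f := N) (fun _ _ => zero_le) hp
  let γ : ℝ → (Fin n → ℝ) := fun t => x + t • (y - x)
  have hγ : Continuous γ := by fun_prop
  have hγs : ∀ s t, γ s - γ t = (s - t) • (y - x) := fun s t => by
    simp only [γ, sub_smul]; abel
  have key := image_le_of_liminf_slope_right_le_deriv_boundary
    (f := fun t => ‖F (γ t) - F x‖) (a := 0) (b := 1)
    (B := fun t => L * ‖y - x‖ * t) (B' := fun _ => L * ‖y - x‖)
    (by fun_prop) (by simp [γ]) (by fun_prop)
    (fun t _ => by simpa using ((hasDerivAt_id t).const_mul (L * ‖y - x‖)).hasDerivWithinAt)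
    (by
      intro t _ r hr
      have h1 : ∃ᶠ z in 𝓝[>] t, ∃ p ∈ S, F (γ z) = affMap p (γ z) :=
        Filter.Frequently.of_forall fun z => hsel _
      obtain ⟨p, hp, hfp⟩ : ∃ p ∈ S, ∃ᶠ z in 𝓝[>] t, F (γ z) = affMap p (γ z) := by
        by_contra! hcon
        refine h1 ?_
        have h2 : ∀ᶠ z in 𝓝[>] t, ∀ p ∈ S, ¬ F (γ z) = affMap p (γ z) :=
          (Filter.eventually_all_finset S).2 fun p hp => hcon p hp
        filter_upwards [h2] with z hz
        rintro ⟨p, hp, h⟩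
        exact hz p hp h
      have haff : Continuous (affMap p) := by unfold affMap; fun_prop
      have ht : F (γ t) = affMap p (γ t) := by
        have hcl : IsClosed {z | F (γ z) = affMap p (γ z)} :=
          isClosed_eq (hc.comp hγ) (haff.comp hγ)
        have hmem : t ∈ closure {z | F (γ z) = affMap p (γ z)} :=
          mem_closure_iff_frequently.2 (hfp.filter_mono nhdsWithin_le_nhds)
        rwa [hcl.closure_eq] at hmem
      refine (hfp.and_eventually self_mem_nhdsWithin).mono ?_
      rintro z ⟨hz, hzt⟩
      have hzt' : 0 < z - t := sub_pos.2 hzt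
      refine lt_of_le_of_lt ?_ hr
      rw [slope_def_field, div_le_iff₀ hzt']
      calc ‖F (γ z) - F x‖ - ‖F (γ t) - F x‖ ≤ ‖F (γ z) - F (γ t)‖ := by
            simpa using norm_sub_norm_le (F (γ z) - F x) (F (γ t) - F x)
        _ ≤ L * ‖γ z - γ t‖ := by rw [hz, ht]; exact hN p hp _ _
        _ = L * ‖y - x‖ * (z - t) := by
            rw [hγs, norm_smul, Real.norm_of_nonneg hzt'.le]; ring)
  simpa [γ] using key (right_mem_Icc.2 zero_le_one)

/-- A Lipschitz perturbation of a large dilation is bijective. -/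
theorem LipschitzWith.bijective_smul_add {E : Type*} [NormedAddCommGroup E] [NormedSpace ℝ E]
    [CompleteSpace E] {f : E → E} {L : ℝ≥0} (hf : LipschitzWith L f) {s : ℝ} (hs : L < s) :
    Function.Bijective fun x => s • x + f x := by
  have hs0 : 0 < s := L.coe_nonneg.trans_lt hs
  have main : ∀ y, ∃! x, s • x + f x = y := by
    intro y
    have hcontr : ContractingWith (L / s.toNNReal) fun x => s⁻¹ • (y - f x) := by
      refine ⟨?_, LipschitzWith.of_dist_le_mul fun u v => ?_⟩
      · rw [div_lt_one (Real.toNNReal_pos.2 hs0)]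
        exact NNReal.coe_lt_coe.1 (by rwa [Real.coe_toNNReal _ hs0.le])
      · rw [dist_smul₀, dist_sub_left, NNReal.coe_div, Real.coe_toNNReal _ hs0.le,
          Real.norm_of_nonneg (inv_nonneg.2 hs0.le), div_eq_inv_mul, mul_assoc]
        gcongr
        exact hf.dist_le_mul u v
    have hiff : ∀ x, s • x + f x = y ↔ s⁻¹ • (y - f x) = x := by
      intro x
      rw [inv_smul_eq_iff₀ hs0.ne', sub_eq_iff_eq_add, eq_comm]
    refine ⟨hcontr.fixedPoint, (hiff _).2 hcontr.fixedPoint_isFixedPt, fun z hz => ?_⟩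
    exact hcontr.fixedPoint_unique ((hiff z).1 hz)
  exact (Function.bijective_iff_existsUnique _).2 main

section DegreeIntegral

variable {E : Type*} [NormedAddCommGroup E] [NormedSpace ℝ E] [FiniteDimensional ℝ E]

/-- A dilation perturbed by an operator of smaller norm has positive determinant. -/
theorem det_smul_id_add_pos {M : E →L[ℝ] E} {s : ℝ} (hs : ‖M‖ < s) :
    0 < (s • ContinuousLinearMap.id ℝ E + M).det := by
  have hs0 : 0 < s := (norm_nonneg M).trans_lt hs
  have hne : ∀ t ∈ Icc (0 : ℝ) 1, (s • ContinuousLinearMap.id ℝ E + t • M).det ≠ 0 := by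
    intro t ht h0
    obtain ⟨v, hv, hv0⟩ : ∃ v ∈ LinearMap.ker
        (s • ContinuousLinearMap.id ℝ E + t • M : E →L[ℝ] E).toLinearMap, v ≠ 0 :=
      Submodule.exists_mem_ne_zero_of_ne_bot
        (LinearMap.bot_lt_ker_of_det_eq_zero h0).ne'
    have hv' : s • v = -(t • M v) := by
      rw [eq_neg_iff_add_eq_zero]
      simpa using hv
    have h1 : s * ‖v‖ ≤ ‖M‖ * ‖v‖ := by
      calc s * ‖v‖ = ‖s • v‖ := by rw [norm_smul, Real.norm_of_nonneg hs0.le]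
        _ = t * ‖M v‖ := by rw [hv', norm_neg, norm_smul, Real.norm_of_nonneg ht.1]
        _ ≤ 1 * ‖M v‖ := by gcongr; exact ht.2
        _ ≤ ‖M‖ * ‖v‖ := by rw [one_mul]; exact M.le_opNorm v
    exact absurd (le_of_mul_le_mul_right h1 (norm_pos_iff.2 hv0)) (not_le.2 hs)
  have hcont : Continuous fun t : ℝ => (s • ContinuousLinearMap.id ℝ E + t • M).det :=
    ContinuousLinearMap.continuous_det.comp (by fun_prop)
  have h0 : 0 < (s • ContinuousLinearMap.id ℝ E + (0 : ℝ) • M).det := by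
    have : (s • ContinuousLinearMap.id ℝ E + (0 : ℝ) • M).det = s ^ Module.finrank ℝ E := by
      simp [ContinuousLinearMap.det]
    rw [this]; positivity
  by_contra! hneg
  obtain ⟨t, ht, h⟩ := intermediate_value_Icc' (zero_le_one' ℝ) hcont.continuousOn
    (show (0 : ℝ) ∈ _ from ⟨by simpa using hneg, h0.le⟩)
  exact hne t ht h

/-- The determinant of an operator is a fixed linear combination of the determinants of its
translates by `finrank ℝ E + 1` distinct multiples of the identity. -/
theorem exists_det_eq_sum_det_smul_id_add {v : ℕ → ℝ} (hv : Function.Injective v) :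
    ∃ w : ℕ → ℝ, ∀ M : E →L[ℝ] E, M.det =
      ∑ i ∈ Finset.range (Module.finrank ℝ E + 1),
        (v i • ContinuousLinearMap.id ℝ E + M).det * w i := by
  refine ⟨fun i => (Lagrange.basis (Finset.range (Module.finrank ℝ E + 1)) v i).eval 0,
    fun M => ?_⟩
  have heval : ∀ t : ℝ, (-M : E →L[ℝ] E).toLinearMap.charpoly.eval t =
      (t • ContinuousLinearMap.id ℝ E + M).det := by
    intro t
    rw [LinearMap.eval_charpoly, ContinuousLinearMap.det]
    congr 1
    ext x
    simp [Module.algebraMap_end_apply]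
  have h := Lagrange.eq_interpolate (f := (-M : E →L[ℝ] E).toLinearMap.charpoly)
    (s := Finset.range (Module.finrank ℝ E + 1)) (v := v) hv.injOn (by
      refine Polynomial.degree_le_natDegree.trans_lt ?_
      rw [LinearMap.charpoly_natDegree, Finset.card_range]
      exact_mod_cast Nat.lt_succ_self _)
  have h0 := congrArg (Polynomial.eval 0) h
  rw [heval, Lagrange.interpolate_apply, Polynomial.eval_finsetSum] at h0
  simpa only [Polynomial.eval_mul, Polynomial.eval_C, heval, zero_smul, zero_add] using h0

variable [MeasurableSpace E] [BorelSpace E]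

/-- The Jacobian of a Lipschitz map translated by a multiple of the identity is locally
integrable. -/
theorem LipschitzWith.integrableOn_det_fderiv_add (μ : Measure E) [IsFiniteMeasureOnCompacts μ]
    {f : E → E} {L : ℝ≥0} (hf : LipschitzWith L f) (s R : ℝ) :
    IntegrableOn (fun x => (s • ContinuousLinearMap.id ℝ E + fderiv ℝ f x).det)
      (Metric.closedBall 0 R) μ := by
  have hcont : Continuous fun M : E →L[ℝ] E => (s • ContinuousLinearMap.id ℝ E + M).det :=
    ContinuousLinearMap.continuous_det.comp (by fun_prop)
  have : FiniteDimensional ℝ (E →L[ℝ] E) := inferInstance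
  have : ProperSpace (E →L[ℝ] E) := FiniteDimensional.proper ℝ _
  have : ProperSpace E := FiniteDimensional.proper ℝ _
  obtain ⟨C, hC⟩ := (isCompact_closedBall (0 : E →L[ℝ] E) L).exists_bound_of_continuousOn
    hcont.continuousOn
  refine Measure.integrableOn_of_bounded (M := C) ?_ ?_ ?_
  · exact (isCompact_closedBall (0 : E) R).measure_lt_top.ne
  · exact (hcont.measurable.comp (measurable_fderiv ℝ f)).aestronglyMeasurable
  · exact Filter.Eventually.of_forall fun x => hC _ (by
      simpa using norm_fderiv_le_of_lipschitz ℝ hf)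

end DegreeIntegral

/-- A Lipschitz self-map of `ℝⁿ` sends null sets to null sets. -/
theorem LipschitzWith.volume_image_eq_zero {n : ℕ} {f : (Fin n → ℝ) → (Fin n → ℝ)} {L : ℝ≥0}
    (hf : LipschitzWith L f) {s : Set (Fin n → ℝ)} (hs : volume s = 0) :
    volume (f '' s) = 0 := by
  rw [← hausdorffMeasure_pi_real] at hs ⊢
  refine le_antisymm ((hf.hausdorffMeasure_image_le (Nat.cast_nonneg _) s).trans ?_) zero_le
  rw [hs, mul_zero]

/-- The Jacobian integral of a Lipschitz perturbation of a large dilation is the volume of its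
image. -/
theorem LipschitzWith.integral_det_smul_id_add_fderiv {n : ℕ}
    {f : (Fin n → ℝ) → (Fin n → ℝ)} {L : ℝ≥0} (hf : LipschitzWith L f) {s : ℝ} (hs : L < s)
    (R : ℝ) :
    ∫ x in Metric.closedBall 0 R, (s • ContinuousLinearMap.id ℝ (Fin n → ℝ) + fderiv ℝ f x).det =
      (volume ((fun x => s • x + f x) '' Metric.closedBall 0 R)).toReal := by
  set h : (Fin n → ℝ) → (Fin n → ℝ) := fun x => s • x + f x
  set h' : (Fin n → ℝ) → ((Fin n → ℝ) →L[ℝ] (Fin n → ℝ)) :=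
    fun x => s • ContinuousLinearMap.id ℝ (Fin n → ℝ) + fderiv ℝ f x
  set B : Set (Fin n → ℝ) := Metric.closedBall 0 R
  let D : Set (Fin n → ℝ) := {x | DifferentiableAt ℝ f x}
  have hDm : MeasurableSet D := measurableSet_of_differentiableAt ℝ f
  have hDnull : volume Dᶜ = 0 := by
    have := hf.ae_differentiableAt (μ := (volume : Measure (Fin n → ℝ)))
    rwa [ae_iff] at this
  have hBm : MeasurableSet B := Metric.isClosed_closedBall.measurableSet
  have hpos : ∀ x, 0 < (h' x).det := fun x =>
    det_smul_id_add_pos ((norm_fderiv_le_of_lipschitz ℝ hf).trans_lt hs)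
  have hlip : LipschitzWith (‖s‖₊ + L) h := (lipschitzWith_smul s).add hf
  have hinj : Function.Injective h := (hf.bijective_smul_add hs).1
  have harea : ∫⁻ x in B ∩ D, ENNReal.ofReal |(h' x).det| = volume (h '' (B ∩ D)) := by
    refine lintegral_abs_det_fderiv_eq_addHaar_image volume (hBm.inter hDm) ?_ hinj.injOn
    rintro x ⟨-, hx⟩
    exact (((hasFDerivAt_id x).const_smul s).add
      (DifferentiableAt.hasFDerivAt hx)).hasFDerivWithinAt
  have himg : volume (h '' (B ∩ D)) = volume (h '' B) := by
    refine measure_congr (ae_eq_set.2 ⟨?_, ?_⟩)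
    · rw [sdiff_eq_empty.2 (image_mono inter_subset_left), measure_empty]
    · refine measure_mono_null ?_ (hlip.volume_image_eq_zero hDnull)
      rintro _ ⟨⟨x, hx, rfl⟩, hnot⟩
      exact ⟨x, fun hxD => hnot ⟨x, ⟨hx, hxD⟩, rfl⟩, rfl⟩
  have hdom : ∫⁻ x in B ∩ D, ENNReal.ofReal |(h' x).det| =
      ∫⁻ x in B, ENNReal.ofReal (h' x).det := by
    rw [setLIntegral_congr (t := B)]
    · exact lintegral_congr fun x => by rw [abs_of_pos (hpos x)]
    · refine ae_eq_set.2 ⟨by rw [sdiff_eq_empty.2 inter_subset_left, measure_empty],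
        measure_mono_null ?_ hDnull⟩
      rintro x ⟨hx, hnot⟩ hxD
      exact hnot ⟨hx, hxD⟩
  have hint := hf.integrableOn_det_fderiv_add volume s R
  rw [integral_eq_lintegral_of_nonneg_ae (Filter.Eventually.of_forall fun x => (hpos x).le)
    hint.aestronglyMeasurable, ← himg, ← harea, hdom]

/-- The Jacobian integral of a Lipschitz self-map of `ℝⁿ` over a ball is determined by the
values of the map outside the ball. -/
theorem LipschitzWith.integral_det_fderiv_eq_of_eqOn_compl {n : ℕ}
    {f g : (Fin n → ℝ) → (Fin n → ℝ)} {L K : ℝ≥0} (hf : LipschitzWith L f)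
    (hg : LipschitzWith K g) {R : ℝ} (hfg : EqOn f g (Metric.closedBall 0 R)ᶜ) :
    ∫ x in Metric.closedBall 0 R, (fderiv ℝ f x).det =
      ∫ x in Metric.closedBall 0 R, (fderiv ℝ g x).det := by
  let v : ℕ → ℝ := fun i => L + K + 1 + i
  have hv : Function.Injective v := fun i j hij => by
    simpa [v] using hij
  obtain ⟨w, hw⟩ := exists_det_eq_sum_det_smul_id_add (E := Fin n → ℝ) hv
  have hexp : ∀ {φ : (Fin n → ℝ) → (Fin n → ℝ)} {C : ℝ≥0}, LipschitzWith C φ →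
      ∫ x in Metric.closedBall 0 R, (fderiv ℝ φ x).det =
        ∑ i ∈ Finset.range (Module.finrank ℝ (Fin n → ℝ) + 1),
          (∫ x in Metric.closedBall 0 R,
            (v i • ContinuousLinearMap.id ℝ (Fin n → ℝ) + fderiv ℝ φ x).det) * w i := by
    intro φ C hφ
    simp_rw [← integral_mul_const]
    rw [← integral_finsetSum]
    · exact integral_congr_ae (Filter.Eventually.of_forall fun x => hw _)
    · exact fun i _ => (hφ.integrableOn_det_fderiv_add volume (v i) R).mul_const _
  rw [hexp hf, hexp hg]
  refine Finset.sum_congr rfl fun i _ => ?_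
  have hLv : L < v i := by
    have := K.coe_nonneg
    simp only [v]; linarith [(Nat.cast_nonneg i : (0 : ℝ) ≤ i)]
  have hKv : K < v i := by
    have := L.coe_nonneg
    simp only [v]; linarith [(Nat.cast_nonneg i : (0 : ℝ) ≤ i)]
  rw [hf.integral_det_smul_id_add_fderiv hLv, hg.integral_det_smul_id_add_fderiv hKv]
  refine congrArg (fun s : Set (Fin n → ℝ) => (volume s).toReal * w i) ?_
  rw [← compl_inj_iff, ← image_compl_eq (hf.bijective_smul_add hLv),
    ← image_compl_eq (hg.bijective_smul_add hKv)]
  exact image_congr fun x hx => by rw [hfg hx]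

/-- If the norm of `g` is locally constant and nonzero near `x`, then the Jacobian of `g`
vanishes at `x`. -/
theorem det_fderiv_eq_zero_of_norm_eventually_eq {E : Type*} [NormedAddCommGroup E]
    [NormedSpace ℝ E] [FiniteDimensional ℝ E] [Nontrivial E] {g : E → E} {x : E} {ρ : ℝ}
    (hρ : 0 < ρ) (hg : ∀ᶠ y in 𝓝 x, ‖g y‖ = ρ) : (fderiv ℝ g x).det = 0 := by
  by_contra hdet
  have hd : DifferentiableAt ℝ g x := by
    by_contra hnd
    rw [fderiv_zero_of_not_differentiableAt hnd] at hdet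
    exact hdet (by simp [ContinuousLinearMap.det])
  have hsurj : Function.Surjective (fderiv ℝ g x) :=
    (LinearMap.equivOfDetNeZero _ hdet).surjective
  obtain ⟨v, hv⟩ := hsurj (g x)
  have hline : HasDerivAt (fun t : ℝ => x + t • v) v 0 := by
    simpa using ((hasDerivAt_id (0 : ℝ)).smul_const v).const_add x
  have hγ : HasDerivAt (fun t : ℝ => g (x + t • v)) (g x) 0 := by
    have h := hd.hasFDerivAt
    rw [← hv]
    exact HasFDerivAt.comp_hasDerivAt_of_eq 0 h hline (by simp)
  have hlo := (hasDerivAt_iff_isLittleO_nhds_zero.1 hγ).def (half_pos hρ)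
  have hnorm : ∀ᶠ t : ℝ in 𝓝 0, ‖g (x + t • v)‖ = ρ := by
    have ht : Filter.Tendsto (fun t : ℝ => x + t • v) (𝓝 0) (𝓝 x) := by
      simpa using hline.continuousAt.tendsto
    exact ht.eventually hg
  obtain ⟨t, ⟨h1, h2⟩, ht⟩ := (((hlo.and hnorm).filter_mono nhdsWithin_le_nhds).and
    (self_mem_nhdsWithin (a := (0 : ℝ)) (s := Ioi 0))).exists
  have ht0 : (0 : ℝ) < t := ht
  simp only [zero_add, zero_smul, add_zero] at h1
  have h3 : ‖g x + t • g x‖ = (1 + t) * ρ := by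
    rw [← hg.self_of_nhds, ← Real.norm_of_nonneg (by positivity : 0 ≤ 1 + t), ← norm_smul,
      add_smul, one_smul]
  have h4 : ‖g x + t • g x‖ ≤ ‖g (x + t • v)‖ + ‖g (x + t • v) - g x - t • g x‖ := by
    have h5 := norm_sub_le (g (x + t • v)) (g (x + t • v) - g x - t • g x)
    rwa [show g (x + t • v) - (g (x + t • v) - g x - t • g x) = g x + t • g x by abel] at h5
  rw [Real.norm_of_nonneg ht0.le] at h1
  nlinarith [mul_pos ht0 hρ]

/-- Pushing a Lipschitz function that stays away from the origin radially out of the ball of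
radius `ρ` yields a Lipschitz function. -/
theorem LipschitzWith.exists_lipschitzWith_max_smul {α E : Type*} [PseudoMetricSpace α]
    [NormedAddCommGroup E] [NormedSpace ℝ E] {f : α → E} {L : ℝ≥0} (hf : LipschitzWith L f)
    {r ρ : ℝ} (hr : 0 < r) (hρ : 0 ≤ ρ) (hfr : ∀ x, r ≤ ‖f x‖) :
    ∃ K : ℝ≥0, LipschitzWith K fun x => max 1 (ρ / ‖f x‖) • f x := by
  refine ⟨(1 + 2 * (ρ / r).toNNReal) * L, LipschitzWith.of_dist_le_mul fun x y => ?_⟩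
  have hx : 0 < ‖f x‖ := hr.trans_le (hfr x)
  have hy : 0 < ‖f y‖ := hr.trans_le (hfr y)
  have hq : 0 ≤ ρ / r := by positivity
  push_cast
  rw [Real.coe_toNNReal _ hq, dist_eq_norm]
  have h1 : max 1 (ρ / ‖f x‖) • f x - max 1 (ρ / ‖f y‖) • f y =
      max 1 (ρ / ‖f x‖) • (f x - f y) + (max 1 (ρ / ‖f x‖) - max 1 (ρ / ‖f y‖)) • f y := by
    rw [smul_sub, sub_smul]; abel
  have h2 : max 1 (ρ / ‖f x‖) ≤ 1 + ρ / r := by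
    have : ρ / ‖f x‖ ≤ ρ / r := by gcongr; exact hfr x
    exact max_le (by linarith) (by linarith)
  have h2' : 0 ≤ max 1 (ρ / ‖f x‖) := zero_le_one.trans (le_max_left _ _)
  have h3 : |max 1 (ρ / ‖f x‖) - max 1 (ρ / ‖f y‖)| * ‖f y‖ ≤ ρ / r * ‖f x - f y‖ := by
    calc |max 1 (ρ / ‖f x‖) - max 1 (ρ / ‖f y‖)| * ‖f y‖
        ≤ |ρ / ‖f x‖ - ρ / ‖f y‖| * ‖f y‖ := by
          refine mul_le_mul_of_nonneg_right ?_ hy.le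
          simpa only [max_comm] using abs_max_sub_max_le_abs (ρ / ‖f x‖) (ρ / ‖f y‖) 1
      _ = ρ / ‖f x‖ * |‖f y‖ - ‖f x‖| := by
          rw [show ρ / ‖f x‖ - ρ / ‖f y‖ = ρ / ‖f x‖ * (‖f y‖ - ‖f x‖) / ‖f y‖ by
            field_simp, abs_div, abs_mul, abs_of_pos hy,
            abs_of_nonneg (by positivity : 0 ≤ ρ / ‖f x‖), div_mul_cancel₀ _ hy.ne']
      _ ≤ ρ / r * ‖f x - f y‖ := by
          gcongr
          · exact hfr x
          · rw [norm_sub_rev]; exact abs_norm_sub_norm_le _ _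
  have h4 : ‖f x - f y‖ ≤ L * dist x y := by
    rw [← dist_eq_norm]; exact hf.dist_le_mul x y
  calc _ ≤ max 1 (ρ / ‖f x‖) * ‖f x - f y‖ +
        |max 1 (ρ / ‖f x‖) - max 1 (ρ / ‖f y‖)| * ‖f y‖ := by
        rw [h1]
        refine (norm_add_le _ _).trans_eq ?_
        rw [norm_smul, norm_smul, Real.norm_of_nonneg h2', Real.norm_eq_abs]
    _ ≤ (1 + ρ / r) * ‖f x - f y‖ + ρ / r * ‖f x - f y‖ := by gcongr
    _ = (1 + 2 * (ρ / r)) * ‖f x - f y‖ := by ring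
    _ ≤ (1 + 2 * (ρ / r)) * (L * dist x y) := by gcongr
    _ = _ := by ring

/-- A Lipschitz self-map of `ℝⁿ` with bounded sublevel sets whose Jacobian has a constant strict
sign (the sign of `σ`) almost everywhere outside a sublevel set has a zero. -/
theorem LipschitzWith.exists_eq_zero_of_det_fderiv_sign {n : ℕ} [Nontrivial (Fin n → ℝ)]
    {f : (Fin n → ℝ) → (Fin n → ℝ)} {L : ℝ≥0} (hf : LipschitzWith L f)
    (hbdd : ∀ M : ℝ, IsBounded {x | ‖f x‖ ≤ M}) {σ ρ : ℝ}
    (hdet : ∀ᵐ x, ρ < ‖f x‖ → 0 < σ * (fderiv ℝ f x).det) : ∃ x, f x = 0 := by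
  by_contra! hne
  have hnc : Continuous fun x => ‖f x‖ := hf.continuous.norm
  obtain ⟨r, hr, hfr⟩ : ∃ r : ℝ, 0 < r ∧ ∀ x, r ≤ ‖f x‖ := by
    have hK : IsCompact {x | ‖f x‖ ≤ ‖f 0‖} :=
      Metric.isCompact_of_isClosed_isBounded (isClosed_le hnc continuous_const) (hbdd _)
    obtain ⟨x₀, -, hx₀⟩ := hK.exists_isMinOn ⟨0, le_refl ‖f 0‖⟩ hnc.continuousOn
    refine ⟨‖f x₀‖, norm_pos_iff.2 (hne x₀), fun x => ?_⟩
    rcases le_total ‖f x‖ ‖f 0‖ with h | h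
    · exact hx₀ h
    · exact le_trans (hx₀ (le_refl ‖f 0‖)) h
  have hcount : {t : ℝ | 0 < volume {x | ‖f x‖ = t}}.Countable :=
    Measure.countable_meas_level_set_pos hnc.measurable
  have hlevel : ∀ m : ℝ, ∃ t, m < t ∧ volume {x | ‖f x‖ = t} = 0 := by
    intro m
    obtain ⟨t, ht, hmt⟩ := (hcount.dense_compl ℝ).exists_gt m
    exact ⟨t, hmt, by simpa using ht⟩
  obtain ⟨a, ha, ha0⟩ := hlevel (max 0 ρ)
  obtain ⟨x₁, hx₁⟩ : ∃ x, a < ‖f x‖ := by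
    by_contra! h
    exact NormedSpace.unbounded_univ ℝ (Fin n → ℝ) ((hbdd a).subset fun x _ => h x)
  obtain ⟨b, hb, hb0⟩ := hlevel ‖f x₁‖
  have hapos : 0 < a := (le_max_left _ _).trans_lt ha
  have hρa : ρ < a := (le_max_right _ _).trans_lt ha
  have hab : a < b := hx₁.trans hb
  let G : ℝ → (Fin n → ℝ) → (Fin n → ℝ) := fun c x => max 1 (c / ‖f x‖) • f x
  have hGf : ∀ {c x}, c ≤ ‖f x‖ → G c x = f x := by
    intro c x hcx
    simp only [G]
    rw [max_eq_left (div_le_one_of_le₀ hcx (norm_nonneg _)), one_smul]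
  have hfd_eq : ∀ {c x}, c < ‖f x‖ → fderiv ℝ (G c) x = fderiv ℝ f x := by
    intro c x hcx
    refine Filter.EventuallyEq.fderiv_eq ?_
    filter_upwards [hnc.continuousAt.eventually (lt_mem_nhds hcx)] with y hy using hGf (le_of_lt hy)
  have hfd_zero : ∀ {c x}, ‖f x‖ < c → (fderiv ℝ (G c) x).det = 0 := by
    intro c x hcx
    refine det_fderiv_eq_zero_of_norm_eventually_eq ((norm_nonneg _).trans_lt hcx) ?_
    filter_upwards [hnc.continuousAt.eventually (gt_mem_nhds hcx)] with y hy
    have hy0 : 0 < ‖f y‖ := norm_pos_iff.2 (hne y)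
    have hy1 : 1 ≤ c / ‖f y‖ := (one_le_div hy0).2 (le_of_lt hy)
    simp only [G]
    rw [max_eq_right hy1, norm_smul, Real.norm_of_nonneg (zero_le_one.trans hy1),
      div_mul_cancel₀ _ hy0.ne']
  obtain ⟨Ka, hKa⟩ := hf.exists_lipschitzWith_max_smul hr hapos.le hfr
  obtain ⟨Kb, hKb⟩ := hf.exists_lipschitzWith_max_smul hr (hapos.trans hab).le hfr
  obtain ⟨R, hR⟩ := (hbdd b).subset_closedBall 0
  have hint_eq := LipschitzWith.integral_det_fderiv_eq_of_eqOn_compl (f := G a) (g := G b)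
    hKa hKb (R := R) (by
      intro x hx
      have hbx : b < ‖f x‖ := by
        by_contra! h
        exact hx (hR h)
      rw [hGf hbx.le, hGf (hab.trans hbx).le])
  have hia : ∀ {c : ℝ} {K : ℝ≥0}, LipschitzWith K (G c) →
      IntegrableOn (fun x => (fderiv ℝ (G c) x).det) (Metric.closedBall 0 R) := by
    intro c K hK
    simpa using hK.integrableOn_det_fderiv_add volume 0 R
  let D : (Fin n → ℝ) → ℝ := fun x => σ * ((fderiv ℝ (G a) x).det - (fderiv ℝ (G b) x).det)
  have hDint : IntegrableOn D (Metric.closedBall 0 R) := ((hia hKa).sub (hia hKb)).const_mul σ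
  have hD0 : ∫ x in Metric.closedBall 0 R, D x = 0 := by
    simp only [D]
    rw [integral_const_mul, integral_sub (hia hKa) (hia hKb), hint_eq, sub_self, mul_zero]
  have hann : ∀ᵐ x, a < ‖f x‖ → ‖f x‖ < b → 0 < D x := by
    filter_upwards [hdet] with x hx hax hxb
    simp only [D]
    rw [hfd_eq hax, hfd_zero hxb, sub_zero]
    exact hx (hρa.trans hax)
  have hlev : ∀ {c : ℝ}, volume {x | ‖f x‖ = c} = 0 → ∀ᵐ x, ‖f x‖ ≠ c := by
    intro c hc
    rw [ae_iff]
    simpa using hc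
  have hDnonneg : ∀ᵐ x, 0 ≤ D x := by
    filter_upwards [hann, hlev ha0, hlev hb0] with x hx hxa hxb
    rcases lt_or_gt_of_ne hxa with h1 | h1
    · simp only [D]
      rw [hfd_zero h1, hfd_zero (h1.trans hab), sub_zero, mul_zero]
    · rcases lt_or_gt_of_ne hxb with h2 | h2
      · exact (hx h1 h2).le
      · simp only [D]
        rw [hfd_eq h1, hfd_eq h2, sub_self, mul_zero]
  have hDzero := (integral_eq_zero_iff_of_nonneg_ae (ae_restrict_of_ae hDnonneg) hDint).1 hD0
  rw [Filter.EventuallyEq, ae_restrict_iff' Metric.isClosed_closedBall.measurableSet] at hDzero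
  have hV : IsOpen {x | a < ‖f x‖ ∧ ‖f x‖ < b} :=
    (isOpen_lt continuous_const hnc).inter (isOpen_lt hnc continuous_const)
  refine (hV.measure_pos volume ⟨x₁, hx₁, hb⟩).ne' ?_
  refine measure_mono_null ?_ (ae_iff.1 (hann.and hDzero))
  rintro x ⟨h1, h2⟩ ⟨h3, h4⟩
  exact (h3 h1 h2).ne' (h4 (hR h2.le))

/-- A polyhedron is convex. -/
theorem IsPolyhedron.convex {n : ℕ} {P : Set (Fin n → ℝ)} (hP : IsPolyhedron P) :
    Convex ℝ P := by
  obtain ⟨m, a, c, rfl⟩ := hP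
  rw [ofPred_forall]
  refine convex_iInter fun i => convex_halfSpace_le ⟨fun x y => ?_, fun t x => ?_⟩ _
  · simp [mul_add, Finset.sum_add_distrib]
  · simp [Finset.mul_sum, mul_left_comm]

/-- The Fréchet derivative of an affine map is its linear part. -/
theorem hasFDerivAt_affMap {n : ℕ} (p : Matrix (Fin n) (Fin n) ℝ × (Fin n → ℝ))
    (x : Fin n → ℝ) :
    HasFDerivAt (affMap p) (Matrix.toLin' p.1).toContinuousLinearMap x :=
  (Matrix.toLin' p.1).toContinuousLinearMap.hasFDerivAt.add_const p.2

/-- Sublevel sets of the norm of an invertible affine map are bounded. -/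
theorem isBounded_norm_affMap_sub_le {n : ℕ} {p : Matrix (Fin n) (Fin n) ℝ × (Fin n → ℝ)}
    (hp : p.1.det ≠ 0) (y : Fin n → ℝ) (M : ℝ) :
    IsBounded {x | ‖affMap p x - y‖ ≤ M} := by
  let T : (Fin n → ℝ) →L[ℝ] (Fin n → ℝ) := (Matrix.toLin' p.1⁻¹).toContinuousLinearMap
  refine (isBounded_iff_forall_norm_le).2 ⟨‖T‖ * (M + ‖y - p.2‖), fun x hx => ?_⟩
  have h1 : T ((affMap p x - y) + (y - p.2)) = x := by
    simp [T, affMap, Matrix.mulVec_mulVec, Matrix.nonsing_inv_mul _ (isUnit_iff_ne_zero.2 hp)]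
  calc ‖x‖ = ‖T ((affMap p x - y) + (y - p.2))‖ := by rw [h1]
    _ ≤ ‖T‖ * ‖(affMap p x - y) + (y - p.2)‖ := T.le_opNorm _
    _ ≤ ‖T‖ * (M + ‖y - p.2‖) := by
      gcongr
      exact (norm_add_le _ _).trans (add_le_add_left hx _)

/-- A piecewise affine function whose linear parts on unbounded polyhedra have determinants of
the sign of `σ` is surjective. -/
theorem IsSubdivision.surjective_of_det_sign {n : ℕ} [Nontrivial (Fin n → ℝ)]
    {F : (Fin n → ℝ) → (Fin n → ℝ)}
    {S : Finset (Matrix (Fin n) (Fin n) ℝ × (Fin n → ℝ))}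
    {𝒞 : Set (Set (Fin n → ℝ))} (h𝒞 : IsSubdivision F S 𝒞) (hF : IsPWA F S) {σ : ℝ}
    (hσ : ∀ p ∈ S, ∀ P ∈ 𝒞, ¬ IsBounded P → ActiveOn F p P → 0 < σ * p.1.det) :
    Function.Surjective F := by
  intro y
  obtain ⟨hfin, hpoly, hcov, hact, -⟩ := h𝒞
  obtain ⟨L, hL⟩ := hF.exists_lipschitzWith
  have hf : LipschitzWith L fun x => F x - y := by
    simpa using hL.sub (LipschitzWith.const y)
  have hmem : ∀ x, ∃ P ∈ 𝒞, x ∈ P := fun x => mem_sUnion.1 (hcov ▸ mem_univ x)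
  have hbdd : ∀ M : ℝ, IsBounded {x | ‖F x - y‖ ≤ M} := by
    intro M
    have hsub : {x | ‖F x - y‖ ≤ M} ⊆ ⋃ P ∈ 𝒞, {x ∈ P | ‖F x - y‖ ≤ M} := by
      intro x hx
      obtain ⟨P, hP, hxP⟩ := hmem x
      exact mem_biUnion hP ⟨hxP, hx⟩
    refine ((isBounded_biUnion hfin).2 fun P hP => ?_).subset hsub
    by_cases hPb : IsBounded P
    · exact hPb.subset fun x hx => hx.1
    · obtain ⟨p, hp, hpP⟩ := hact P hP
      refine (isBounded_norm_affMap_sub_le (right_ne_zero_of_mul (hσ p hp P hP hPb hpP).ne') y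
        M).subset ?_
      rintro x ⟨hxP, hx⟩
      rwa [hpP x hxP] at hx
  obtain ⟨ρ, hρ⟩ : ∃ ρ : ℝ, ∀ P ∈ 𝒞, IsBounded P → ∀ x ∈ P, ‖F x - y‖ ≤ ρ := by
    have hU : IsBounded (⋃ P ∈ {P ∈ 𝒞 | IsBounded P}, P) :=
      (isBounded_biUnion (hfin.subset (sep_subset _ _))).2 fun P hP => hP.2
    obtain ⟨ρ, hρ⟩ := isBounded_iff_forall_norm_le.1 (hf.isBounded_image hU)
    exact ⟨ρ, fun P hP hPb x hx => hρ _ ⟨x, mem_biUnion (⟨hP, hPb⟩ : P ∈ {P ∈ 𝒞 | _}) hx, rfl⟩⟩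
  have hfront : ∀ᵐ x, ∀ P ∈ 𝒞, x ∉ frontier P :=
    (ae_ball_iff hfin.countable).2 fun P hP => by
      rw [ae_iff]
      simpa using (hpoly P hP).1.convex.addHaar_frontier volume
  obtain ⟨x, hx⟩ := hf.exists_eq_zero_of_det_fderiv_sign hbdd (σ := σ) (ρ := ρ) (by
    filter_upwards [hfront] with x hx hρx
    obtain ⟨P, hP, hxP⟩ := hmem x
    have hPb : ¬ IsBounded P := fun h => (hρ P hP h x hxP).not_gt hρx
    obtain ⟨p, hp, hpP⟩ := hact P hP
    have hint : x ∈ interior P := by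
      by_contra h
      exact hx P hP ⟨subset_closure hxP, h⟩
    have hev : (fun z => F z - y) =ᶠ[𝓝 x] fun z => affMap p z - y := by
      filter_upwards [mem_interior_iff_mem_nhds.1 hint] with z hz
      rw [hpP z hz]
    rw [hev.fderiv_eq, ((hasFDerivAt_affMap p x).sub_const y).fderiv]
    simpa [ContinuousLinearMap.det] using hσ p hp P hP hPb hpP)
  exact ⟨x, sub_eq_zero.1 hx⟩

/-- If all selection functions of a piecewise affine `F : ℝⁿ → ℝⁿ`
that are active on unbounded polyhedra of a corresponding subdivision `𝒞` have linear
parts with the same nonzero determinant sign, then `F` is surjective. -/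
theorem surjective_of_coherently_oriented_at_infinity
    {n : ℕ} (F : (Fin n → ℝ) → (Fin n → ℝ))
    (S : Finset (Matrix (Fin n) (Fin n) ℝ × (Fin n → ℝ)))
    (𝒞 : Set (Set (Fin n → ℝ)))
    (hF : IsPWA F S) (h𝒞 : IsSubdivision F S 𝒞)
    (hco : (∀ p ∈ S, ∀ P ∈ 𝒞, ¬ IsBounded P → ActiveOn F p P → 0 < p.1.det) ∨
           (∀ p ∈ S, ∀ P ∈ 𝒞, ¬ IsBounded P → ActiveOn F p P → p.1.det < 0)) :
    Function.Surjective F := by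
  rcases n with _ | n
  · exact fun y => ⟨y, Subsingleton.elim _ _⟩
  · rcases hco with h | h
    · exact h𝒞.surjective_of_det_sign hF (σ := 1) fun p hp P hP hPb hpP => by
        simpa using h p hp P hP hPb hpP
    · exact h𝒞.surjective_of_det_sign hF (σ := -1) fun p hp P hP hPb hpP => by
        simpa using h p hp P hP hPb hpP
end
end

section
/- Every injective piecewise affine function F : ℝ^n → ℝ^n is coherently oriented, i.e. the linear parts A_i of all of its selection functions have the same nonzero determinant sign (all det A_i > 0 or all det A_i < 0). -/
open Set Filter Bornology

noncomputable section

section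

open Matrix

/-- Finitely many nondegenerate linear equations are simultaneously avoidable in an open set. -/
theorem exists_mem_forall_dotProduct_ne {ι : Type*} [Finite ι] {n : ℕ} (f : ι → Fin n → ℝ)
    (c : ι → ℝ) {U : Set (Fin n → ℝ)} (hU : IsOpen U) (hne : U.Nonempty) :
    ∃ x ∈ U, ∀ i, f i ≠ 0 → f i ⬝ᵥ x ≠ c i := by
  have key : Dense (⋂ i, {x : Fin n → ℝ | f i ≠ 0 → f i ⬝ᵥ x ≠ c i}) := by
    refine dense_iInter_of_isOpen (fun i => ?_) (fun i => ?_)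
    · by_cases h : f i = 0
      · simp [h]
      · simp only [ne_eq, h, not_false_eq_true, forall_const]
        exact isOpen_ne_fun (by fun_prop) continuous_const
    · by_cases h : f i = 0
      · simp [h]
      · simp only [ne_eq, h, not_false_eq_true, forall_const]
        intro x
        by_cases hx : f i ⬝ᵥ x = c i
        · have hpos : f i ⬝ᵥ f i ≠ 0 := fun h0 => h (dotProduct_self_eq_zero.1 h0)
          have hlim : Tendsto (fun t : ℝ => x + t • f i) (nhdsWithin 0 {0}ᶜ) (nhds x) := by
            have : Continuous fun t : ℝ => x + t • f i := by fun_prop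
            simpa using (this.tendsto 0).mono_left nhdsWithin_le_nhds
          refine mem_closure_of_tendsto hlim ?_
          filter_upwards [self_mem_nhdsWithin] with t ht
          simp only [dotProduct_add, dotProduct_smul, hx, smul_eq_mul]
          intro h0
          have : t * (f i ⬝ᵥ f i) = 0 := by linarith
          exact (mul_ne_zero ht hpos) this
        · exact subset_closure hx
  obtain ⟨x, hxU, hx⟩ := key.inter_open_nonempty U hU hne
  exact ⟨x, hxU, fun i => mem_iInter.1 hx i⟩

/-- Two nonempty open sets are joined by a segment meeting finitely many hyperplanes one at a
time: hyperplanes passing through a common point of the segment are parallel. -/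
theorem exists_segment_forall_parallel {ι : Type*} [Finite ι] {n : ℕ} (f : ι → Fin n → ℝ)
    (c : ι → ℝ) {U W : Set (Fin n → ℝ)} (hU : IsOpen U) (hU' : U.Nonempty) (hW : IsOpen W)
    (hW' : W.Nonempty) :
    ∃ x ∈ U, ∃ y ∈ W, ∀ z ∈ segment ℝ x y, ∀ i j, f i ≠ 0 → f i ⬝ᵥ z = c i →
      f j ⬝ᵥ z = c j → ∃ a : ℝ, f j = a • f i := by
  obtain ⟨x, hxU, hx⟩ := exists_mem_forall_dotProduct_ne f c hU hU'
  let h : ι × ι → Fin n → ℝ := fun k =>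
    (f k.2 ⬝ᵥ x - c k.2) • f k.1 - (f k.1 ⬝ᵥ x - c k.1) • f k.2
  obtain ⟨y, hyW, hy⟩ := exists_mem_forall_dotProduct_ne h (fun k => h k ⬝ᵥ x) hW hW'
  refine ⟨x, hxU, y, hyW, fun z hz i j hi hzi hzj => ?_⟩
  rw [segment_eq_image'] at hz
  obtain ⟨t, -, rfl⟩ := hz
  have hxi : f i ⬝ᵥ x - c i ≠ 0 := sub_ne_zero.2 (hx i hi)
  by_cases hij : h (i, j) = 0
  · refine ⟨(f j ⬝ᵥ x - c j) / (f i ⬝ᵥ x - c i), ?_⟩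
    rw [div_eq_inv_mul, mul_smul, sub_eq_zero.1 hij, inv_smul_smul₀ hxi]
  · exfalso
    have hne := hy (i, j) hij
    simp only [dotProduct_add, dotProduct_smul, dotProduct_sub, smul_eq_mul] at hzi hzj
    have hzero : t * (h (i, j) ⬝ᵥ y - h (i, j) ⬝ᵥ x) = 0 := by
      simp only [h, sub_dotProduct, smul_dotProduct, smul_eq_mul]
      linear_combination (f j ⬝ᵥ x - c j) * hzi - (f i ⬝ᵥ x - c i) * hzj
    rcases mul_eq_zero.1 hzero with ht | ht
    · rw [ht] at hzi
      exact hxi (by linarith)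
    · exact hne (sub_eq_zero.1 ht)

/-- A continuous map which on a preconnected set is everywhere one of finitely many continuous
maps with disjoint graphs coincides with a single one of them. -/
theorem eqOn_of_isPreconnected {ι X Y : Type*} [TopologicalSpace X] [TopologicalSpace Y]
    [T2Space Y] {K : Set X} (hK : IsPreconnected K) (T : Finset ι) {f : ι → X → Y}
    (hf : ∀ i, Continuous (f i)) {F : X → Y} (hF : Continuous F)
    (hcov : ∀ x ∈ K, ∃ i ∈ T, F x = f i x)
    (huniq : ∀ i ∈ T, ∀ j ∈ T, ∀ x ∈ K, f i x = f j x → i = j) {i : ι} (hi : i ∈ T) {x : X}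
    (hx : x ∈ K) (hix : F x = f i x) : EqOn F (f i) K := by
  classical
  intro y hy
  by_contra hne
  have hcl : ∀ j, IsClosed {x | F x = f j x} := fun j => isClosed_eq hF (hf j)
  obtain ⟨w, hwK, hw1, hw2⟩ := isPreconnected_closed_iff.1 hK _
    (⋃ j ∈ T.erase i, {x | F x = f j x}) (hcl i)
    ((T.erase i).finite_toSet.isClosed_biUnion fun j _ => hcl j)
    (fun w hw => by
      obtain ⟨j, hj, hjw⟩ := hcov w hw
      by_cases hji : j = i
      · exact Or.inl (hji ▸ hjw)
      · exact Or.inr (mem_biUnion (Finset.mem_erase.2 ⟨hji, hj⟩) hjw))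
    ⟨x, hx, hix⟩
    (by
      obtain ⟨j, hj, hjy⟩ := hcov y hy
      refine ⟨y, hy, mem_biUnion (Finset.mem_erase.2 ⟨?_, hj⟩) hjy⟩
      rintro rfl
      exact hne hjy)
  obtain ⟨j, hj, hjw⟩ := mem_iUnion₂.1 hw2
  obtain ⟨hji, hjT⟩ := Finset.mem_erase.1 hj
  exact hji (huniq j hjT i hi w hwK (hjw.symm.trans hw1))

variable {n : ℕ} {F : (Fin n → ℝ) → (Fin n → ℝ)}
  {S : Finset (Matrix (Fin n) (Fin n) ℝ × (Fin n → ℝ))}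
  {p q : Matrix (Fin n) (Fin n) ℝ × (Fin n → ℝ)}

theorem continuous_affMap (p : Matrix (Fin n) (Fin n) ℝ × (Fin n → ℝ)) :
    Continuous (affMap p) := by
  unfold affMap
  fun_prop

theorem affMap_add (p : Matrix (Fin n) (Fin n) ℝ × (Fin n → ℝ)) (x v : Fin n → ℝ) :
    affMap p (x + v) = affMap p x + p.1 *ᵥ v := by
  simp only [affMap, mulVec_add]
  abel

theorem vecMulVec_mulVec_eq_smul (u g v : Fin n → ℝ) :
    vecMulVec u g *ᵥ v = (g ⬝ᵥ v) • u := by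
  rw [vecMulVec_mulVec]
  ext i
  simp [mul_comm]

/-- An injective map has no fold: the linear parts of two affine pieces adjacent along a
hyperplane do not have determinants of opposite signs. -/
theorem det_mul_det_nonneg_of_adjacent (hinj : Function.Injective F) {g u z : Fin n → ℝ} {ε : ℝ}
    (hε : 0 < ε) (hp : ∀ x ∈ Metric.ball z ε, 0 < g ⬝ᵥ (x - z) → F x = affMap p x)
    (hq : ∀ x ∈ Metric.ball z ε, 0 < (-g) ⬝ᵥ (x - z) → F x = affMap q x)
    (hz : affMap p z = affMap q z) (hu : q.1 = p.1 + vecMulVec u g) :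
    0 ≤ p.1.det * q.1.det := by
  by_contra! hneg
  have hp0 : p.1.det ≠ 0 := by
    intro h
    simp [h] at hneg
  have hunit : IsUnit p.1.det := isUnit_iff_ne_zero.2 hp0
  set w : Fin n → ℝ := p.1⁻¹ *ᵥ u
  have hpw : p.1 *ᵥ w = u := by
    rw [mulVec_mulVec, mul_nonsing_inv _ hunit, one_mulVec]
  have hqw : q.1 *ᵥ w = (1 + g ⬝ᵥ w) • u := by
    rw [hu, add_mulVec, hpw, vecMulVec_mulVec_eq_smul, add_smul, one_smul]
  have hdet : q.1.det = p.1.det * (1 + g ⬝ᵥ w) := by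
    have : q.1 = p.1 * (1 + replicateCol Unit w * replicateRow Unit g) := by
      rw [← vecMulVec_eq, mul_add, mul_one, mul_vecMulVec, hpw, hu]
    rw [this, det_mul, det_one_add_replicateCol_mul_replicateRow]
  set α := g ⬝ᵥ w
  have hα : 1 + α < 0 := by
    by_contra! h
    rw [hdet] at hneg
    nlinarith [mul_nonneg (mul_self_nonneg p.1.det) h]
  have hball : ∀ᶠ s in nhdsWithin (0 : ℝ) (Ioi 0),
      z + s • w ∈ Metric.ball z ε ∧ z + (s * (1 + α)) • w ∈ Metric.ball z ε := by
    have h1 : Continuous fun s : ℝ => z + s • w := by fun_prop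
    have h2 : Continuous fun s : ℝ => z + (s * (1 + α)) • w := by fun_prop
    refine ((h1.tendsto' 0 z (by simp)).eventually (Metric.ball_mem_nhds z hε)).and
      ((h2.tendsto' 0 z (by simp)).eventually (Metric.ball_mem_nhds z hε)) |>.filter_mono
      nhdsWithin_le_nhds
  obtain ⟨s, ⟨hs1, hs2⟩, hs⟩ := (hball.and self_mem_nhdsWithin).exists
  have hs : 0 < s := hs
  have e1 := hq _ hs1 (by
    simp only [add_sub_cancel_left, dotProduct_smul, neg_dotProduct, smul_eq_mul]
    change 0 < s * -α
    nlinarith)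
  have e2 := hp _ hs2 (by
    simp only [add_sub_cancel_left, dotProduct_smul, smul_eq_mul]
    change 0 < s * (1 + α) * α
    exact mul_pos_of_neg_of_neg (mul_neg_of_pos_of_neg hs hα) (by linarith))
  have heq : z + s • w = z + (s * (1 + α)) • w := hinj (by
    rw [e1, e2, affMap_add, affMap_add, mulVec_smul, mulVec_smul, hpw, hqw, hz, smul_smul])
  have h0 := congrArg (fun v => g ⬝ᵥ v) heq
  simp only [dotProduct_add, dotProduct_smul, smul_eq_mul] at h0
  change g ⬝ᵥ z + s * α = g ⬝ᵥ z + s * (1 + α) * α at h0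
  have : 0 < s * (α * α) := mul_pos hs (by nlinarith)
  nlinarith

/-- Near a point where all active affine pieces differ by rank one maps along a common
hyperplane, an injective map has no two pieces with determinants of opposite signs. -/
theorem det_mul_det_nonneg_of_forall_rank_one (hF : IsPWA F S) (hinj : Function.Injective F)
    {z g : Fin n → ℝ} (hg : g ≠ 0) (hrank : ∀ r ∈ S, ∀ s ∈ S, F z = affMap r z →
      F z = affMap s z → ∃ u : Fin n → ℝ, s.1 = r.1 + vecMulVec u g)
    (hp : p ∈ S) (hq : q ∈ S) (hpz : z ∈ closure (interior {x | F x = affMap p x}))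
    (hqz : z ∈ closure (interior {x | F x = affMap q x})) : 0 ≤ p.1.det * q.1.det := by
  classical
  have hcl : ∀ r, IsClosed {x | F x = affMap r x} :=
    fun r => isClosed_eq hF.1 (continuous_affMap r)
  set T := S.filter fun r => F z = affMap r z with hT
  obtain ⟨ε, hε, hball⟩ : ∃ ε > 0, ∀ x ∈ Metric.ball z ε, ∃ r ∈ T, F x = affMap r x := by
    have hopen : IsOpen (⋃ r ∈ S \ T, {x | F x = affMap r x})ᶜ :=
      ((S \ T).finite_toSet.isClosed_biUnion fun r _ => hcl r).isOpen_compl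
    obtain ⟨ε, hε, hsub⟩ := Metric.isOpen_iff.1 hopen z (by
      simp only [hT, mem_compl_iff, mem_iUnion, not_exists]
      intro r hr hrz
      obtain ⟨h1, h2⟩ := Finset.mem_sdiff.1 hr
      exact h2 (Finset.mem_filter.2 ⟨h1, hrz⟩))
    refine ⟨ε, hε, fun x hx => ?_⟩
    obtain ⟨r, hr, hrx⟩ := hF.2 x
    refine ⟨r, ?_, hrx⟩
    by_contra hrT
    exact hsub hx (mem_biUnion (Finset.mem_sdiff.2 ⟨hr, hrT⟩) hrx)
  have huniq : ∀ r ∈ T, ∀ s ∈ T, ∀ x, g ⬝ᵥ (x - z) ≠ 0 → affMap r x = affMap s x → r = s := by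
    intro r hr s hs x hx hrs
    obtain ⟨hrS, hrz⟩ := Finset.mem_filter.1 hr
    obtain ⟨hsS, hsz⟩ := Finset.mem_filter.1 hs
    obtain ⟨u, hu⟩ := hrank r hrS s hsS hrz hsz
    have hz := hrz.symm.trans hsz
    have hx' : x = z + (x - z) := by abel
    rw [hx', affMap_add, affMap_add, hz, hu, add_mulVec, vecMulVec_mulVec_eq_smul] at hrs
    have hu0 : u = 0 := by
      have : (g ⬝ᵥ (x - z)) • u = 0 := by simpa using hrs
      exact (smul_eq_zero.1 this).resolve_left hx
    have h1 : r.1 = s.1 := by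
      rw [hu, hu0]
      ext
      simp
    refine Prod.ext h1 ?_
    simpa [affMap, h1] using hz
  have hpoint : ∀ r, z ∈ closure (interior {x | F x = affMap r x}) →
      ∃ x ∈ Metric.ball z ε, g ⬝ᵥ (x - z) ≠ 0 ∧ F x = affMap r x := by
    intro r hr
    have hne := mem_closure_iff.1 hr _ Metric.isOpen_ball (Metric.mem_ball_self hε)
    obtain ⟨x, ⟨hx1, hx2⟩, hx⟩ := exists_mem_forall_dotProduct_ne (fun _ : Unit => g)
      (fun _ => g ⬝ᵥ z) (Metric.isOpen_ball.inter isOpen_interior) hne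
    have hrx : x ∈ {x | F x = affMap r x} := interior_subset hx2
    refine ⟨x, hx1, ?_, hrx⟩
    rw [dotProduct_sub]
    exact sub_ne_zero.2 (hx () hg)
  have hside : ∀ g' : Fin n → ℝ, (g' = g ∨ g' = -g) → ∀ r ∈ T, ∀ x ∈ Metric.ball z ε,
      0 < g' ⬝ᵥ (x - z) → F x = affMap r x →
      ∀ y ∈ Metric.ball z ε, 0 < g' ⬝ᵥ (y - z) → F y = affMap r y := by
    intro g' hg' r hr x hx hgx hrx y hy hgy
    have hlin : IsLinearMap ℝ fun y : Fin n → ℝ => g' ⬝ᵥ y :=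
      ⟨fun a b => dotProduct_add _ _ _, fun c a => dotProduct_smul _ _ _⟩
    have hconv : Convex ℝ (Metric.ball z ε ∩ {y | g' ⬝ᵥ z < g' ⬝ᵥ y}) :=
      (convex_ball z ε).inter (convex_halfSpace_gt hlin _)
    have hmem : ∀ y, 0 < g' ⬝ᵥ (y - z) ↔ y ∈ {y | g' ⬝ᵥ z < g' ⬝ᵥ y} := by
      intro y
      rw [dotProduct_sub, sub_pos, mem_ofPred_eq]
    refine eqOn_of_isPreconnected hconv.isPreconnected T continuous_affMap hF.1
      (fun w hw => hball w hw.1) (fun i hi j hj w hw => huniq i hi j hj w ?_) hr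
      ⟨hx, (hmem x).1 hgx⟩ hrx ⟨hy, (hmem y).1 hgy⟩
    have := (hmem w).2 hw.2
    rcases hg' with rfl | rfl
    · exact this.ne'
    · rw [neg_dotProduct] at this
      exact (neg_pos.1 this).ne
  have hFz : ∀ r, z ∈ closure (interior {x | F x = affMap r x}) → F z = affMap r z :=
    fun r hr => closure_minimal interior_subset (hcl r) hr
  have hpT : p ∈ T := Finset.mem_filter.2 ⟨hp, hFz p hpz⟩
  have hqT : q ∈ T := Finset.mem_filter.2 ⟨hq, hFz q hqz⟩
  by_cases hpq : p = q
  · rw [hpq]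
    exact mul_self_nonneg _
  obtain ⟨x, hx, hgx, hpx⟩ := hpoint p hpz
  obtain ⟨y, hy, hgy, hqy⟩ := hpoint q hqz
  obtain ⟨u, hu⟩ := hrank p hp q hq (hFz p hpz) (hFz q hqz)
  have hzpq := (hFz p hpz).symm.trans (hFz q hqz)
  have hsame : ∀ g' : Fin n → ℝ, (g' = g ∨ g' = -g) → 0 < g' ⬝ᵥ (x - z) →
      ¬ 0 < g' ⬝ᵥ (y - z) := fun g' hg' h1 h2 =>
    hpq (huniq p hpT q hqT y hgy ((hside g' hg' p hpT x hx h1 hpx y hy h2).symm.trans hqy))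
  rcases hgx.lt_or_gt with h1 | h1
  · have h1' : 0 < (-g) ⬝ᵥ (x - z) := by rw [neg_dotProduct]; linarith
    have h2 : 0 < g ⬝ᵥ (y - z) := by
      have := hsame (-g) (Or.inr rfl) h1'
      rw [neg_dotProduct] at this
      exact lt_of_le_of_ne (by linarith) hgy.symm
    refine det_mul_det_nonneg_of_adjacent (g := -g) (u := -u) hinj hε
      (hside (-g) (Or.inr rfl) p hpT x hx h1' hpx) ?_ hzpq ?_
    · rw [neg_neg]
      exact hside g (Or.inl rfl) q hqT y hy h2 hqy
    · rw [hu]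
      ext
      simp [vecMulVec_apply]
  · have h2 : 0 < (-g) ⬝ᵥ (y - z) := by
      have := hsame g (Or.inl rfl) h1
      rw [neg_dotProduct]
      linarith [lt_of_le_of_ne (not_lt.1 this) hgy]
    exact det_mul_det_nonneg_of_adjacent hinj hε (hside g (Or.inl rfl) p hpT x hx h1 hpx)
      (hside (-g) (Or.inr rfl) q hqT y hy h2 hqy) hzpq hu

/-- An affine map active on a set with nonempty interior for an injective map has nonsingular
linear part. -/
theorem det_ne_zero_of_activeOn (hinj : Function.Injective F) {U : Set (Fin n → ℝ)}
    (hU : (interior U).Nonempty) (hp : ActiveOn F p U) : p.1.det ≠ 0 := by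
  intro hdet
  obtain ⟨v, hv, hpv⟩ := exists_mulVec_eq_zero_iff.2 hdet
  obtain ⟨x, hx⟩ := hU
  have hcont : Continuous fun t : ℝ => x + t • v := by fun_prop
  have hev : ∀ᶠ t in nhdsWithin (0 : ℝ) {0}ᶜ, x + t • v ∈ interior U :=
    ((hcont.tendsto' 0 x (by simp)).eventually
      (isOpen_interior.mem_nhds hx)).filter_mono nhdsWithin_le_nhds
  obtain ⟨t, ht, ht0⟩ := (hev.and self_mem_nhdsWithin).exists
  have heq : x + t • v = x := hinj (by
    rw [hp _ (interior_subset ht), hp _ (interior_subset hx), affMap_add, mulVec_smul, hpv,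
      smul_zero, add_zero])
  exact (smul_ne_zero ht0 hv) (by simpa using heq)

/-- The closures of the interiors of the activity regions of a piecewise affine function cover
the whole space. -/
theorem IsPWA.exists_mem_closure_interior (hF : IsPWA F S) (x : Fin n → ℝ) :
    ∃ p ∈ S, x ∈ closure (interior {x | F x = affMap p x}) := by
  have hdense := dense_iUnion_interior_of_closed
    (f := fun p : S => {x | F x = affMap p.1 x})
    (fun p => isClosed_eq hF.1 (continuous_affMap p.1)) (by
      refine eq_univ_of_forall fun x => ?_
      obtain ⟨p, hp, hpx⟩ := hF.2 x
      exact mem_iUnion.2 ⟨⟨p, hp⟩, hpx⟩)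
  have hx := hdense x
  rw [closure_iUnion_of_finite] at hx
  obtain ⟨p, hp⟩ := mem_iUnion.1 hx
  exact ⟨p.1, p.2, hp⟩

/-- If active pieces with both determinant signs occur, then along some segment two of them meet
at a point where all active pieces differ by rank one maps along a common hyperplane. -/
theorem exists_crossing (hF : IsPWA F S) (hdet : ∀ r ∈ S, r.1.det ≠ 0)
    (hp : p ∈ S) (hq : q ∈ S) (hp0 : 0 < p.1.det) (hq0 : q.1.det < 0)
    (hpi : (interior {x | F x = affMap p x}).Nonempty)
    (hqi : (interior {x | F x = affMap q x}).Nonempty) :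
    ∃ r ∈ S, ∃ s ∈ S, ∃ z g : Fin n → ℝ, 0 < r.1.det ∧ s.1.det < 0 ∧ g ≠ 0 ∧
      z ∈ closure (interior {x | F x = affMap r x}) ∧
      z ∈ closure (interior {x | F x = affMap s x}) ∧
      ∀ a ∈ S, ∀ b ∈ S, F z = affMap a z → F z = affMap b z →
        ∃ u : Fin n → ℝ, b.1 = a.1 + vecMulVec u g := by
  let f : S × S × Fin n → Fin n → ℝ := fun k => k.2.1.1.1 k.2.2 - k.1.1.1 k.2.2
  let c : S × S × Fin n → ℝ := fun k => k.1.1.2 k.2.2 - k.2.1.1.2 k.2.2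
  obtain ⟨x, hx, y, hy, hxy⟩ := exists_segment_forall_parallel f c isOpen_interior hpi
    isOpen_interior hqi
  have hfc : ∀ (a b : S) (k : Fin n) (z : Fin n → ℝ), F z = affMap a.1 z → F z = affMap b.1 z →
      f (a, b, k) ⬝ᵥ z = c (a, b, k) := by
    intro a b k z ha hb
    have := congrFun (ha.symm.trans hb) k
    simp only [affMap, mulVec, Pi.add_apply] at this
    simp only [f, c, sub_dotProduct]
    linarith
  let D : Matrix (Fin n) (Fin n) ℝ × (Fin n → ℝ) → Set (Fin n → ℝ) :=
    fun r => closure (interior {x | F x = affMap r x})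
  have hDF : ∀ r, ∀ z ∈ D r, F z = affMap r z := fun r z hz =>
    closure_minimal interior_subset (isClosed_eq hF.1 (continuous_affMap r)) hz
  have hcl : ∀ T : Finset (Matrix (Fin n) (Fin n) ℝ × (Fin n → ℝ)), IsClosed (⋃ r ∈ T, D r) :=
    fun T => T.finite_toSet.isClosed_biUnion fun r _ => isClosed_closure
  have hcov : segment ℝ x y ⊆ (⋃ r ∈ S.filter (fun r => 0 < r.1.det), D r) ∪
      ⋃ r ∈ S.filter (fun r => r.1.det < 0), D r := by
    intro w _
    obtain ⟨r, hr, hrw⟩ := hF.exists_mem_closure_interior w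
    rcases (hdet r hr).lt_or_gt with h | h
    · exact Or.inr (mem_iUnion₂.2 ⟨r, Finset.mem_filter.2 ⟨hr, h⟩, hrw⟩)
    · exact Or.inl (mem_iUnion₂.2 ⟨r, Finset.mem_filter.2 ⟨hr, h⟩, hrw⟩)
  have hxD : x ∈ ⋃ r ∈ S.filter (fun r => 0 < r.1.det), D r :=
    mem_iUnion₂.2 ⟨p, Finset.mem_filter.2 ⟨hp, hp0⟩, subset_closure hx⟩
  have hyD : y ∈ ⋃ r ∈ S.filter (fun r => r.1.det < 0), D r :=
    mem_iUnion₂.2 ⟨q, Finset.mem_filter.2 ⟨hq, hq0⟩, subset_closure hy⟩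
  obtain ⟨z, hz, hz1, hz2⟩ := isPreconnected_closed_iff.1 (convex_segment x y).isPreconnected
    _ _ (hcl _) (hcl _) hcov ⟨x, left_mem_segment ℝ x y, hxD⟩ ⟨y, right_mem_segment ℝ x y, hyD⟩
  obtain ⟨r, hr, hrz⟩ := mem_iUnion₂.1 hz1
  obtain ⟨s, hs, hsz⟩ := mem_iUnion₂.1 hz2
  obtain ⟨hr, hr0⟩ := Finset.mem_filter.1 hr
  obtain ⟨hs, hs0⟩ := Finset.mem_filter.1 hs
  obtain ⟨k, hk⟩ : ∃ k, f (⟨r, hr⟩, ⟨s, hs⟩, k) ≠ 0 := by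
    by_contra! h
    have hrs : s.1 = r.1 := funext fun k => sub_eq_zero.1 (h k)
    rw [hrs] at hs0
    exact lt_asymm hr0 hs0
  refine ⟨r, hr, s, hs, z, f (⟨r, hr⟩, ⟨s, hs⟩, k), hr0, hs0, hk, hrz, hsz, fun a ha b hb haz hbz => ?_⟩
  have hpar : ∀ i, ∃ t : ℝ, f (⟨a, ha⟩, ⟨b, hb⟩, i) = t • f (⟨r, hr⟩, ⟨s, hs⟩, k) := fun i =>
    hxy z hz _ _ hk (hfc ⟨r, hr⟩ ⟨s, hs⟩ k z (hDF r z hrz) (hDF s z hsz))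
      (hfc ⟨a, ha⟩ ⟨b, hb⟩ i z haz hbz)
  choose u hu using hpar
  refine ⟨u, ?_⟩
  ext i j
  have := congrFun (hu i) j
  rw [Pi.smul_apply, smul_eq_mul] at this
  rw [Matrix.add_apply, vecMulVec_apply, ← this]
  simp only [f, Pi.sub_apply]
  ring

end

/-- An injective piecewise affine function `F : ℝⁿ → ℝⁿ` (each of whose
selection functions is active on some set with nonempty interior) is coherently oriented:
the determinants of the linear parts of its selection functions are all positive or all
negative. -/
theorem coherentlyOriented_of_injective
    {n : ℕ} (F : (Fin n → ℝ) → (Fin n → ℝ))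
    (S : Finset (Matrix (Fin n) (Fin n) ℝ × (Fin n → ℝ)))
    (hF : IsPWA F S)
    (hact : ∀ p ∈ S, ∃ U : Set (Fin n → ℝ), (interior U).Nonempty ∧ ActiveOn F p U)
    (hinj : Function.Injective F) :
    (∀ p ∈ S, 0 < p.1.det) ∨ (∀ p ∈ S, p.1.det < 0) := by
  have hdet : ∀ r ∈ S, r.1.det ≠ 0 := fun r hr => by
    obtain ⟨U, hU, hr⟩ := hact r hr
    exact det_ne_zero_of_activeOn hinj hU hr
  have hint : ∀ r ∈ S, (interior {x | F x = affMap r x}).Nonempty := fun r hr => by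
    obtain ⟨U, hU, hr⟩ := hact r hr
    exact hU.mono (interior_mono hr)
  by_contra! h
  obtain ⟨⟨q, hq, hq0⟩, p, hp, hp0⟩ := h
  obtain ⟨r, hr, s, hs, z, g, hr0, hs0, hg, hrz, hsz, hrank⟩ :=
    exists_crossing hF hdet hp hq (lt_of_le_of_ne hp0 (hdet p hp).symm)
      (lt_of_le_of_ne hq0 (hdet q hq)) (hint p hp) (hint q hq)
  exact absurd (det_mul_det_nonneg_of_forall_rank_one hF hinj hg hrank hr hs hrz hsz)
    (not_le.2 (mul_neg_of_pos_of_neg hr0 hs0))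
end
end

section
/- Every injective piecewise affine function F : ℝ^n → ℝ^n is surjective (hence bijective). -/
open Set Filter Bornology

noncomputable section

section PiecewiseAffine

variable {E G ι : Type*} [NormedAddCommGroup E] [NormedSpace ℝ E]
  [AddCommGroup G] [Module ℝ G]

/-- An affine map whose linear part has rank at least two, so that its zero set has
codimension at least two. -/
def HasRankTwo (f : E →ᵃ[ℝ] G) : Prop :=
  ∀ v : G, ∃ u : E, f.linear u ∉ Submodule.span ℝ {v}

/-- The preimage of a line through the origin under a map of rank at least two is proper. -/
theorem HasRankTwo.comap_span_ne_top {f : E →ᵃ[ℝ] G} (hf : HasRankTwo f) (v : G) :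
    AffineSubspace.comap f (Submodule.span ℝ {v}).toAffineSubspace ≠ ⊤ := by
  obtain ⟨u, hu⟩ := hf v
  intro h
  have hmem : ∀ x, f x ∈ Submodule.span ℝ {v} := fun x => by
    have : x ∈ AffineSubspace.comap f (Submodule.span ℝ {v}).toAffineSubspace := by simp [h]
    simpa using this
  apply hu
  have := Submodule.sub_mem _ (hmem u) (hmem 0)
  simpa [f.decomp'] using this

/-- If the range of `(D, D')` lies in a line and `D ≠ 0`, then `ker D ≤ ker D'`. -/
theorem apply_eq_zero_of_prod_mem_span {V W : Type*} [AddCommGroup V] [Module ℝ V]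
    [AddCommGroup W] [Module ℝ W] {D D' : V →ₗ[ℝ] W} {v : W × W}
    (h : ∀ u, (D u, D' u) ∈ Submodule.span ℝ {v}) (hD : D ≠ 0) {u : V} (hu : D u = 0) :
    D' u = 0 := by
  have hv : v.1 ≠ 0 := by
    intro hv
    apply hD
    ext w
    obtain ⟨c, hc⟩ := Submodule.mem_span_singleton.1 (h w)
    have := congrArg Prod.fst hc
    simpa [hv] using this.symm
  obtain ⟨c, hc⟩ := Submodule.mem_span_singleton.1 (h u)
  have h1 := congrArg Prod.fst hc
  have h2 := congrArg Prod.snd hc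
  simp only [Prod.smul_fst, Prod.smul_snd, hu] at h1 h2
  rw [← h2, (smul_eq_zero.1 h1).resolve_right hv, zero_smul]

/-- If the differences of the affine isomorphisms active at `x` are pairwise of joint rank at most
one, they vanish along a common hyperplane. -/
theorem exists_common_kernel (p : ι → E ≃ᵃ[ℝ] E) {x y : E}
    (hrank : ∀ i j k l, y = p i x → y = p j x → y = p k x → y = p l x → ∃ v : E × E, ∀ u,
      ((p i).linear u - (p j).linear u, (p k).linear u - (p l).linear u) ∈
        Submodule.span ℝ {v}) :
    ∃ h : E →ₗ[ℝ] ℝ, ∀ i j, y = p i x → y = p j x → p i ≠ p j →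
      ∀ u, (p i).linear u = (p j).linear u ↔ h u = 0 := by
  by_cases hex : ∃ i j, y = p i x ∧ y = p j x ∧ p i ≠ p j
  swap
  · exact ⟨0, fun i j hi hj hij => absurd ⟨i, j, hi, hj, hij⟩ hex⟩
  let D : ι → ι → E →ₗ[ℝ] E := fun i j =>
    ((p i).linear : E →ₗ[ℝ] E) - ((p j).linear : E →ₗ[ℝ] E)
  have hD : ∀ i j, y = p i x → y = p j x → p i ≠ p j → D i j ≠ 0 := by
    intro i j hi hj hij h0
    apply hij
    ext z
    have h1 := (p i).map_vadd x (z - x)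
    have h2 := (p j).map_vadd x (z - x)
    have h3 : (p i).linear (z - x) = (p j).linear (z - x) :=
      sub_eq_zero.1 (LinearMap.congr_fun h0 (z - x))
    simp only [vadd_eq_add, sub_add_cancel] at h1 h2
    rw [h1, h2, h3, ← hi, ← hj]
  obtain ⟨i, j, hi, hj, hij⟩ := hex
  obtain ⟨v, hv⟩ := hrank i j i j hi hj hi hj
  have hline : ∀ u, ∃ c : ℝ, c • v.1 = D i j u := fun u => by
    obtain ⟨c, hc⟩ := Submodule.mem_span_singleton.1 (hv u)
    exact ⟨c, congrArg Prod.fst hc⟩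
  have hv1 : v.1 ≠ 0 := by
    intro hv1
    apply hD i j hi hj hij
    ext u
    obtain ⟨c, hc⟩ := hline u
    rw [← hc, hv1, smul_zero, LinearMap.zero_apply]
  obtain ⟨φ, hφ⟩ : ∃ φ : Module.Dual ℝ E, φ v.1 ≠ 0 := by
    by_contra! hall
    exact hv1 ((Module.forall_dual_apply_eq_zero_iff ℝ v.1).1 hall)
  refine ⟨φ ∘ₗ D i j, fun k l hk hl hkl u => ?_⟩
  have hφD : φ (D i j u) = 0 ↔ D i j u = 0 := by
    obtain ⟨c, hc⟩ := hline u
    simp [← hc, hφ, hv1]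
  obtain ⟨w, hw⟩ := hrank i j k l hi hj hk hl
  obtain ⟨w', hw'⟩ := hrank k l i j hk hl hi hj
  rw [LinearMap.comp_apply, hφD, ← sub_eq_zero]
  exact ⟨apply_eq_zero_of_prod_mem_span (D := D k l) (D' := D i j) hw' (hD k l hk hl hkl),
    apply_eq_zero_of_prod_mem_span (D := D i j) (D' := D k l) hw (hD i j hi hj hij)⟩

/-- The pair of differences `(a - b, c - d)`, precomposed with the inverse of `a`. -/
def differencePair (a b c d : E ≃ᵃ[ℝ] E) : E →ᵃ[ℝ] E × E :=
  (((a : E →ᵃ[ℝ] E) - (b : E →ᵃ[ℝ] E)).prod ((c : E →ᵃ[ℝ] E) - (d : E →ᵃ[ℝ] E))).comp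
    (a.symm : E →ᵃ[ℝ] E)

theorem differencePair_eq_zero {a b c d : E ≃ᵃ[ℝ] E} {x y : E} (ha : y = a x) (hb : y = b x)
    (hc : y = c x) (hd : y = d x) : differencePair a b c d y = 0 := by
  have hx : a.symm y = x := by rw [ha, a.symm_apply_apply]
  simp [differencePair, hx, ← ha, ← hb, ← hc, ← hd]

theorem differencePair_linear_apply (a b c d : E ≃ᵃ[ℝ] E) (u : E) :
    (differencePair a b c d).linear (a.linear u) =
      (a.linear u - b.linear u, c.linear u - d.linear u) := by
  simp [differencePair]

variable [FiniteDimensional ℝ E] [Finite ι]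

/-- Finitely many proper affine subspaces do not cover a nonempty open set. -/
theorem exists_mem_forall_notMem_affineSubspace {U : Set E} (hU : IsOpen U) (hne : U.Nonempty)
    (W : ι → AffineSubspace ℝ E) (hW : ∀ i, W i ≠ ⊤) : ∃ x ∈ U, ∀ i, x ∉ W i := by
  borelize E
  let μ : MeasureTheory.Measure E := MeasureTheory.Measure.addHaar
  have hnull : μ (⋃ i, (W i : Set E)) = 0 :=
    MeasureTheory.measure_iUnion_null fun i => μ.addHaar_affineSubspace _ (hW i)
  by_contra! h
  have hsub : U ⊆ ⋃ i, (W i : Set E) := fun x hx => by simpa using h x hx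
  exact (hU.measure_pos μ hne).ne' (MeasureTheory.measure_mono_null hsub hnull)

/-- Two nonempty open sets are joined by a segment avoiding the zero sets of finitely many affine
maps of rank at least two. -/
theorem exists_segment_avoiding {U V : Set E} (hU : IsOpen U) (hUne : U.Nonempty)
    (hV : IsOpen V) (hVne : V.Nonempty) (f : ι → E →ᵃ[ℝ] G) (hf : ∀ i, HasRankTwo (f i)) :
    ∃ x ∈ U, ∃ y ∈ V, ∀ z ∈ segment ℝ x y, ∀ i, f i z ≠ 0 := by
  obtain ⟨y, hyV, hy⟩ := exists_mem_forall_notMem_affineSubspace hV hVne _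
    fun i => (hf i).comap_span_ne_top 0
  obtain ⟨x, hxU, hx⟩ := exists_mem_forall_notMem_affineSubspace hU hUne _
    fun i => (hf i).comap_span_ne_top (f i y)
  refine ⟨x, hxU, y, hyV, fun z hz i hzero => ?_⟩
  have hyi : f i y ≠ 0 := by simpa using hy i
  have hxi : f i x ∉ Submodule.span ℝ {f i y} := by simpa using hx i
  rw [segment_eq_image_lineMap] at hz
  obtain ⟨t, -, rfl⟩ := hz
  rw [AffineMap.apply_lineMap, AffineMap.lineMap_apply_module] at hzero
  by_cases ht : 1 - t = 0
  · rw [ht, zero_smul, zero_add, show t = 1 by linarith, one_smul] at hzero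
    exact hyi hzero
  · apply hxi
    rw [← Submodule.smul_mem_iff _ ht, eq_neg_of_add_eq_zero_left hzero]
    exact Submodule.neg_mem _ (Submodule.smul_mem _ _ (Submodule.mem_span_singleton_self _))

/-- On a preconnected set where the selections of a continuous function are pairwise either equal
or nowhere equal, a single selection is active. -/
theorem exists_selection_eqOn {X Y : Type*} [TopologicalSpace X] [TopologicalSpace Y] [T2Space Y]
    {F : X → Y} (hF : Continuous F) {q : ι → X → Y} (hq : ∀ i, Continuous (q i))
    {I : Set ι} (hI : I.Nonempty) {C : Set X} (hC : IsPreconnected C)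
    (hcover : ∀ x ∈ C, ∃ i ∈ I, F x = q i x)
    (hdisj : ∀ i ∈ I, ∀ j ∈ I, q i ≠ q j → ∀ x ∈ C, q i x ≠ q j x) :
    ∃ i ∈ I, ∀ x ∈ C, F x = q i x := by
  rcases C.eq_empty_or_nonempty with rfl | ⟨x₀, hx₀⟩
  · exact ⟨hI.some, hI.some_mem, by simp⟩
  obtain ⟨i, hi, hxi⟩ := hcover x₀ hx₀
  refine ⟨i, hi, ?_⟩
  have hclosed : ∀ j, IsClosed {x | F x = q j x} := fun j => isClosed_eq hF (hq j)
  have hJ : IsClosed (⋃ j ∈ {j ∈ I | q i ≠ q j}, {x | F x = q j x}) :=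
    (Set.toFinite _).isClosed_biUnion fun j _ => hclosed j
  refine (isPreconnected_iff_subset_of_disjoint_closed.1 hC _ _ (hclosed i) hJ ?_ ?_).elim
    (fun h => h) fun h => ?_
  · intro x hx
    obtain ⟨j, hj, hxj⟩ := hcover x hx
    by_cases hij : q i = q j
    · exact Or.inl (by simpa [hij] using hxj)
    · exact Or.inr (Set.mem_iUnion₂.2 ⟨j, ⟨hj, hij⟩, hxj⟩)
  · refine Set.eq_empty_of_forall_notMem fun x ⟨hx, hxi, hxJ⟩ => ?_
    obtain ⟨j, ⟨hj, hij⟩, hxj⟩ := Set.mem_iUnion₂.1 hxJ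
    exact hdisj i hi j hj hij x hx ((Eq.symm hxi).trans hxj)
  · obtain ⟨j, ⟨hj, hij⟩, hxj⟩ := Set.mem_iUnion₂.1 (h hx₀)
    exact absurd (hxi.symm.trans hxj) (hdisj i hi j hj hij x₀ hx₀)

/-- An injective function that agrees near `x` with one affine isomorphism on each side of a
hyperplane through `x` covers a neighbourhood of `F x`. -/
theorem range_mem_nhds_of_two_pieces {F : E → E} (hinj : Function.Injective F) {x : E}
    (p q : E ≃ᵃ[ℝ] E) (hp : F x = p x) (hq : F x = q x) (h : E →ₗ[ℝ] ℝ)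
    (hnear : ∀ᶠ z in nhds x, (0 ≤ h (z - x) → F z = p z) ∧ (h (z - x) ≤ 0 → F z = q z)) :
    Set.range F ∈ nhds (F x) := by
  have hlim : ∀ e : E ≃ᵃ[ℝ] E, F x = e x → Tendsto e.symm (nhds (F x)) (nhds x) := by
    intro e he
    have hc : Continuous e.symm := (e.symm : E →ᵃ[ℝ] E).continuous_of_finiteDimensional
    simpa [he] using hc.tendsto (F x)
  filter_upwards [(hlim p hp).eventually hnear, (hlim q hq).eventually hnear] with y hyp hyq
  by_cases h1 : 0 ≤ h (p.symm y - x)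
  · exact ⟨p.symm y, by simpa using hyp.1 h1⟩
  by_cases h2 : h (q.symm y - x) ≤ 0
  · exact ⟨q.symm y, by simpa using hyq.2 h2⟩
  exfalso
  push Not at h1 h2
  set a := p.symm y - x with ha
  set b := q.symm y - x with hb
  have hpa : p.linear a = y - F x := by
    have := p.map_vadd x a
    rw [vadd_eq_add, vadd_eq_add, ha, sub_add_cancel, p.apply_symm_apply] at this
    rw [this, hp, add_sub_cancel_right]
  have hqb : q.linear b = y - F x := by
    have := q.map_vadd x b
    rw [vadd_eq_add, vadd_eq_add, hb, sub_add_cancel, q.apply_symm_apply] at this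
    rw [this, hq, add_sub_cancel_right]
  have hline : ∀ c : E, ∀ᶠ s : ℝ in nhdsWithin 0 (Set.Ioi 0),
      (0 ≤ h (x - s • c - x) → F (x - s • c) = p (x - s • c)) ∧
        (h (x - s • c - x) ≤ 0 → F (x - s • c) = q (x - s • c)) := by
    intro c
    have : Tendsto (fun s : ℝ => x - s • c) (nhdsWithin 0 (Set.Ioi 0)) (nhds x) := by
      have hc : Continuous fun s : ℝ => x - s • c := by fun_prop
      simpa using (hc.tendsto 0).mono_left nhdsWithin_le_nhds
    exact this.eventually hnear
  obtain ⟨s, ⟨hsa, hsb⟩, hs⟩ := ((hline a).and (hline b)).and self_mem_nhdsWithin |>.exists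
  have hs : 0 < s := hs
  have key : x - s • a = x - s • b := by
    apply hinj
    rw [hsa.1 (by simp; nlinarith), hsb.2 (by simp; nlinarith)]
    have hps := p.map_vadd x (-(s • a))
    have hqs := q.map_vadd x (-(s • b))
    simp only [vadd_eq_add, map_neg, map_smul, hpa, hqb, neg_add_eq_sub] at hps hqs
    rw [hps, hqs, ← hp, ← hq]
  have hab : a = b := smul_right_injective E hs.ne' (sub_right_injective key)
  rw [hab] at h1
  exact lt_asymm h1 h2

/-- If the differences of the affine isomorphisms active at `x` all vanish along a common
hyperplane, the range of an injective piecewise affine function is a neighbourhood of `F x`. -/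
theorem range_mem_nhds_of_common_kernel {F : E → E} (hF : Continuous F)
    (hinj : Function.Injective F) (p : ι → E ≃ᵃ[ℝ] E) (hcover : ∀ x, ∃ i, F x = p i x) {x : E}
    (h : E →ₗ[ℝ] ℝ)
    (hker : ∀ i j, F x = p i x → F x = p j x → p i ≠ p j →
      ∀ u, (p i).linear u = (p j).linear u ↔ h u = 0) :
    Set.range F ∈ nhds (F x) := by
  have hcont : ∀ i, Continuous (p i) := fun i =>
    (p i : E →ᵃ[ℝ] E).continuous_of_finiteDimensional
  let I : Set ι := {i | F x = p i x}
  have hI : I.Nonempty := hcover x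
  have heq : ∀ i ∈ I, ∀ j ∈ I, p i ≠ p j → ∀ z, p i z = p j z ↔ h (z - x) = 0 := by
    intro i hi j hj hij z
    have h1 := (p i).map_vadd x (z - x)
    have h2 := (p j).map_vadd x (z - x)
    simp only [vadd_eq_add, sub_add_cancel] at h1 h2
    rw [← hker i j hi hj hij, h1, h2, ← show F x = p i x from hi, ← show F x = p j x from hj,
      add_left_inj]
  have hact : ∀ᶠ z in nhds x, ∀ i, F z = p i z → i ∈ I := by
    refine eventually_all.2 fun i => ?_
    by_cases hi : i ∈ I
    · exact Eventually.of_forall fun _ _ => hi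
    · filter_upwards [(isOpen_ne_fun hF (hcont i)).mem_nhds hi] with z hz hz'
      exact absurd hz' hz
  obtain ⟨ε, hε, hball⟩ := Metric.eventually_nhds_iff_ball.1 hact
  have hside : ∀ g : E →ₗ[ℝ] ℝ, (∀ u, h u = 0 → g u = 0) →
      ∃ i ∈ I, ∀ z ∈ Metric.ball x ε, 0 ≤ g (z - x) → (h (z - x) = 0 ∨ g (z - x) ≠ 0) →
        F z = p i z := by
    intro g hg
    have hC : Convex ℝ (Metric.ball x ε ∩ {z | g x < g z}) :=
      (convex_ball x ε).inter (convex_halfSpace_gt g.isLinear _)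
    obtain ⟨i, hi, hFi⟩ := exists_selection_eqOn hF hcont hI hC.isPreconnected
      (fun z hz => (hcover z).imp fun i hi => ⟨hball z hz.1 i hi, hi⟩)
      (fun i hi j hj hij z hz hz' => by
        have h0 := hg _ ((heq i hi j hj (fun e => hij (by rw [e])) z).1 hz')
        rw [map_sub, sub_eq_zero] at h0
        exact hz.2.ne' h0)
    refine ⟨i, hi, fun z hz hgz hor => ?_⟩
    rcases hor with hz0 | hne
    · obtain ⟨j, hj⟩ := hcover z
      by_cases hij : p i = p j
      · rw [hj, hij]
      · rw [hj, (heq i hi j (hball z hz j hj) hij z).2 hz0]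
    · exact hFi z ⟨hz, by simpa using lt_of_le_of_ne hgz hne.symm⟩
  obtain ⟨i, hi, hFi⟩ := hside h fun _ => id
  obtain ⟨j, hj, hFj⟩ := hside (-h) fun u hu => by simp [hu]
  refine range_mem_nhds_of_two_pieces hinj (p i) (p j) hi hj h ?_
  filter_upwards [Metric.ball_mem_nhds x hε] with z hz
  exact ⟨fun hz' => hFi z hz hz' (em _),
    fun hz' => hFj z hz (by simpa using hz')
      (by simpa only [LinearMap.neg_apply, neg_ne_zero] using em _)⟩

/-- If some selection agrees with an injective function on a set with nonempty interior, then it is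
bijective. -/
theorem bijective_of_eqOn_open {F : E → E} (hinj : Function.Injective F)
    (q : E →ᵃ[ℝ] E) (hq : (interior {x | F x = q x}).Nonempty) : Function.Bijective q := by
  have hlin : Function.Injective q.linear := by
    rw [injective_iff_map_eq_zero]
    intro u hu
    obtain ⟨x, hx⟩ := hq
    have hlim : Tendsto (fun t : ℝ => t • u + x) (nhdsWithin 0 {0}ᶜ) (nhds x) := by
      have hc : Continuous fun t : ℝ => t • u + x := by fun_prop
      simpa using (hc.tendsto 0).mono_left nhdsWithin_le_nhds
    obtain ⟨t, ht, ht0⟩ :=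
      ((hlim.eventually (mem_interior_iff_mem_nhds.1 hx)).and self_mem_nhdsWithin).exists
    have ht : F (t • u + x) = q (t • u + x) := ht
    have hFx : x ∈ {x | F x = q x} := interior_subset hx
    have hval := q.map_vadd x (t • u)
    simp only [vadd_eq_add, map_smul, hu, smul_zero, zero_add] at hval
    have := hinj (ht.trans (hval.trans (Eq.symm hFx)))
    exact (smul_eq_zero.1 (add_eq_right.1 this)).resolve_left ht0
  exact q.linear_bijective_iff.1 ⟨hlin, LinearMap.injective_iff_surjective.1 hlin⟩

/-- An injective continuous function that is piecewise given by finitely many affine isomorphisms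
is surjective. -/
theorem surjective_of_injective_of_affineEquiv {F : E → E} (hF : Continuous F)
    (hinj : Function.Injective F) (p : ι → E ≃ᵃ[ℝ] E) (hcover : ∀ x, ∃ i, F x = p i x) :
    Function.Surjective F := by
  have hcont : ∀ i, Continuous (p i) := fun i =>
    (p i : E →ᵃ[ℝ] E).continuous_of_finiteDimensional
  have hhomeo : ∀ i, IsHomeomorph (p i) := fun i =>
    (p i).toContinuousAffineEquiv.toHomeomorph.isHomeomorph
  have hclosed : ∀ i, IsClosed {x | F x = p i x} := fun i => isClosed_eq hF (hcont i)
  have hunion : ⋃ i, {x | F x = p i x} = Set.univ :=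
    Set.eq_univ_of_forall fun x => Set.mem_iUnion.2 (hcover x)
  have hrange : IsClosed (Set.range F) := by
    have : Set.range F = ⋃ i, p i '' {x | F x = p i x} := by
      ext y
      simp only [Set.mem_range, Set.mem_iUnion, Set.mem_image, Set.mem_ofPred_eq]
      constructor
      · rintro ⟨x, rfl⟩
        obtain ⟨i, hi⟩ := hcover x
        exact ⟨i, x, hi, hi.symm⟩
      · rintro ⟨i, x, hx, rfl⟩
        exact ⟨x, hx⟩
    rw [this]
    exact isClosed_iUnion_of_finite fun i => (hhomeo i).isClosedMap _ (hclosed i)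
  have hint : (interior (Set.range F)).Nonempty := by
    obtain ⟨i, x, hx⟩ := nonempty_interior_of_iUnion_of_closed hclosed hunion
    refine ⟨p i x, mem_interior.2 ⟨_, ?_, (hhomeo i).isOpenMap _ isOpen_interior,
      Set.mem_image_of_mem _ hx⟩⟩
    rintro _ ⟨z, hz, rfl⟩
    have hFz : z ∈ {x | F x = p i x} := interior_subset hz
    exact ⟨z, hFz⟩
  by_contra hsurj
  have hcompl : (Set.range F)ᶜ.Nonempty := by
    rwa [Set.nonempty_compl, Ne, Set.range_eq_univ]
  let f : ι × ι × ι × ι → E →ᵃ[ℝ] E × E := fun s =>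
    differencePair (p s.1) (p s.2.1) (p s.2.2.1) (p s.2.2.2)
  obtain ⟨y₀, hy₀, y₁, hy₁, hseg⟩ := exists_segment_avoiding isOpen_interior hint
    hrange.isOpen_compl hcompl (fun s : {s // HasRankTwo (f s)} => f s) fun s => s.2
  have hsub : segment ℝ y₀ y₁ ⊆ interior (Set.range F) ∪ (Set.range F)ᶜ := by
    intro y hy
    by_cases hyF : y ∈ Set.range F
    swap
    · exact Or.inr hyF
    left
    obtain ⟨x, rfl⟩ := hyF
    rw [mem_interior_iff_mem_nhds]
    refine (exists_common_kernel p (x := x) (y := F x) fun i j k l hi hj hk hl => ?_).elim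
      fun h hker => range_mem_nhds_of_common_kernel hF hinj p hcover h hker
    have hnot : ¬ HasRankTwo (f (i, j, k, l)) := fun hr =>
      hseg (F x) hy ⟨(i, j, k, l), hr⟩ (differencePair_eq_zero hi hj hk hl)
    simp only [HasRankTwo, not_forall, not_exists, not_not] at hnot
    obtain ⟨v, hv⟩ := hnot
    refine ⟨v, fun u => ?_⟩
    rw [← differencePair_linear_apply]
    exact hv _
  obtain ⟨y, -, hy, hy'⟩ := (convex_segment y₀ y₁).isPreconnected _ _ isOpen_interior
    hrange.isOpen_compl hsub ⟨y₀, left_mem_segment ℝ _ _, hy₀⟩ ⟨y₁, right_mem_segment ℝ _ _, hy₁⟩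
  exact hy' (interior_subset hy)

/-- An injective continuous function that is piecewise given by finitely many affine maps is
surjective. -/
theorem surjective_of_injective_of_affineMap {F : E → E} (hF : Continuous F)
    (hinj : Function.Injective F) (q : ι → E →ᵃ[ℝ] E) (hcover : ∀ x, ∃ i, F x = q i x) :
    Function.Surjective F := by
  have hclosed : ∀ i, IsClosed {x | F x = q i x} := fun i =>
    isClosed_eq hF (q i).continuous_of_finiteDimensional
  have hdense : Dense (⋃ i, interior {x | F x = q i x}) :=
    dense_iUnion_interior_of_closed hclosed
      (Set.eq_univ_of_forall fun x => Set.mem_iUnion.2 (hcover x))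
  let J := {i // Function.Bijective (q i)}
  have hJclosed : IsClosed (⋃ i : J, {x | F x = q i x}) :=
    isClosed_iUnion_of_finite fun i => hclosed i
  have hsub : ⋃ i, interior {x | F x = q i x} ⊆ ⋃ i : J, {x | F x = q i x} := by
    refine Set.iUnion_subset fun i x hx => Set.mem_iUnion.2 ⟨⟨i, ?_⟩, interior_subset hx⟩
    exact bijective_of_eqOn_open hinj (q i) ⟨x, hx⟩
  refine surjective_of_injective_of_affineEquiv hF hinj
    (fun i : J => AffineEquiv.ofBijective i.2) fun x => ?_
  have hx : x ∈ ⋃ i : J, {x | F x = q i x} :=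
    hJclosed.closure_subset_iff.2 hsub (hdense x)
  simpa using hx

end PiecewiseAffine

/-- Every injective piecewise affine function `F : ℝⁿ → ℝⁿ` is
surjective (hence bijective). -/
theorem surjective_of_injective_pwa
    {n : ℕ} (F : (Fin n → ℝ) → (Fin n → ℝ))
    (S : Finset (Matrix (Fin n) (Fin n) ℝ × (Fin n → ℝ)))
    (hF : IsPWA F S) (hinj : Function.Injective F) :
    Function.Surjective F := by
  obtain ⟨hcont, hsel⟩ := hF
  refine surjective_of_injective_of_affineMap hcont hinj
    (fun p : S => p.1.1.mulVecLin.toAffineMap + AffineMap.const ℝ _ p.1.2) fun x => ?_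
  obtain ⟨p, hp, hx⟩ := hsel x
  exact ⟨⟨p, hp⟩, by simpa [affMap] using hx⟩
end
end
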